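/- arXiv:2102.00049 — 2 statements merged into one kernel-verified Lean document; each statement's English description precedes it below -/
import Mathlib

section
/- Let h : S¹ → S¹ be an orientation-preserving homeomorphism such that ∫₀^{2π} ∫₀^{π/2} e^{q ρ_h^c(θ,t)} dt dθ < ∞ for some q > 0. Then there exists an orientation-preserving homeomorphism H of the closed unit disk onto itself with H restricted to S¹ equal to h, such that H is continuously differentiable on the open unit disk 𝔻 with positive Jacobian determinant, and there exists p > 0 with ∫_𝔻 e^{p K_H(x,y)} dx dy < ∞ (i.e. H has exponentially integrable distortion). -/
open MeasureTheory Set Function Real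

noncomputable section

/-- The length of the arc of the unit circle from `a` to `b` in the positive orientation:
the unique `s ∈ [0, 2π)` with `b = a·e^{is}`. -/
def arcLen (a b : Circle) : ℝ :=
  if 0 ≤ Complex.arg ((b : ℂ) / (a : ℂ)) then Complex.arg ((b : ℂ) / (a : ℂ))
  else Complex.arg ((b : ℂ) / (a : ℂ)) + 2 * π

/-- The circular symmetric distortion function of a circle homeomorphism `h`. -/
def rhoCirc (h : Circle → Circle) (θ t : ℝ) : ℝ :=
  max (arcLen (h (Circle.exp θ)) (h (Circle.exp (θ + t))) /
        arcLen (h (Circle.exp (θ - t))) (h (Circle.exp θ)))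
      (arcLen (h (Circle.exp (θ - t))) (h (Circle.exp θ)) /
        arcLen (h (Circle.exp θ)) (h (Circle.exp (θ + t))))

/-- `h : S¹ → S¹` is an orientation-preserving homeomorphism: it lifts to an increasing
homeomorphism of `ℝ` commuting with the translation `x ↦ x + 2π`. -/
def IsOrientationPresHomeo (h : Circle → Circle) : Prop :=
  ∃ g : ℝ → ℝ, StrictMono g ∧ Continuous g ∧ Surjective g ∧
    (∀ θ : ℝ, g (θ + 2 * π) = g θ + 2 * π) ∧
    ∀ θ : ℝ, h (Circle.exp θ) = Circle.exp (g θ)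

/-- The quasiconformal dilatation `‖DH‖²/J_H` of a map `H : ℂ → ℂ` at the point `z`. -/
def dilC (H : ℂ → ℂ) (z : ℂ) : ℝ :=
  ‖fderiv ℝ H z‖ ^ 2 / (fderiv ℝ H z).det

/-! ### A cut-off for the averaging scale -/

/-- The `C¹` function `t ↦ max(t, 0)²`. -/
def posSq (t : ℝ) : ℝ := max t 0 ^ 2

lemma hasDerivAt_posSq (t : ℝ) : HasDerivAt posSq (2 * max t 0) t := by
  rcases lt_trichotomy t 0 with ht | rfl | ht
  · have h0 : HasDerivAt (fun _ : ℝ => (0 : ℝ)) 0 t := hasDerivAt_const _ _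
    rw [max_eq_right ht.le, mul_zero]
    refine h0.congr_of_eventuallyEq ?_
    filter_upwards [Iio_mem_nhds ht] with s hs
    simp [posSq, max_eq_right (le_of_lt (mem_Iio.1 hs))]
  · rw [max_self, mul_zero, hasDerivAt_iff_isLittleO]
    simp only [posSq, max_self, sub_zero, smul_zero]
    have h1 : (fun s : ℝ => max s 0 ^ 2 - 0 ^ 2) =O[nhds 0] fun s : ℝ => s ^ 2 := by
      refine Asymptotics.IsBigO.of_bound 1 (Filter.Eventually.of_forall fun s => ?_)
      rcases le_total s 0 with hs | hs
      · simp [max_eq_right hs, sq_nonneg]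
      · simp [max_eq_left hs]
    exact h1.trans_isLittleO (by simpa using Asymptotics.isLittleO_pow_id (𝕜 := ℝ) one_lt_two)
  · have h0 : HasDerivAt (fun s : ℝ => s ^ 2) (2 * t) t := by simpa using hasDerivAt_pow 2 t
    rw [max_eq_left ht.le]
    refine h0.congr_of_eventuallyEq ?_
    filter_upwards [Ioi_mem_nhds ht] with s hs
    simp [posSq, max_eq_left (le_of_lt (mem_Ioi.1 hs))]

/-- The averaging scale at height `y`: it equals `y` for `y ≤ π` and `2π` for `y ≥ 3π`. -/
def cutScale (y : ℝ) : ℝ := y - (posSq (y - π) - posSq (y - 3 * π)) / (4 * π)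

/-- The derivative of `cutScale`. -/
def cutScaleDeriv (y : ℝ) : ℝ := 1 - (max (y - π) 0 - max (y - 3 * π) 0) / (2 * π)

lemma hasDerivAt_cutScale (y : ℝ) : HasDerivAt cutScale (cutScaleDeriv y) y := by
  have h1 := (hasDerivAt_posSq (y - π)).comp_sub_const y π
  have h2 := (hasDerivAt_posSq (y - 3 * π)).comp_sub_const y (3 * π)
  have h3 : HasDerivAt cutScale _ y := (hasDerivAt_id y).sub ((h1.sub h2).div_const (4 * π))
  refine h3.congr_deriv ?_
  rw [cutScaleDeriv]
  field_simp
  ring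

lemma continuous_cutScaleDeriv : Continuous cutScaleDeriv := by
  unfold cutScaleDeriv
  fun_prop

lemma contDiff_cutScale : ContDiff ℝ 1 cutScale := by
  rw [contDiff_one_iff_deriv]
  refine ⟨fun y => (hasDerivAt_cutScale y).differentiableAt, ?_⟩
  rw [show deriv cutScale = cutScaleDeriv from funext fun y => (hasDerivAt_cutScale y).deriv]
  exact continuous_cutScaleDeriv

lemma cutScaleDeriv_nonneg (y : ℝ) : 0 ≤ cutScaleDeriv y := by
  have hpi := Real.pi_pos
  rw [cutScaleDeriv, sub_nonneg, div_le_one (by positivity)]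
  rcases max_cases (y - π) 0 with h1 | h1 <;> rcases max_cases (y - 3 * π) 0 with h2 | h2 <;>
    linarith

lemma cutScaleDeriv_le_one (y : ℝ) : cutScaleDeriv y ≤ 1 := by
  have hpi := Real.pi_pos
  rw [cutScaleDeriv, sub_le_self_iff]
  refine div_nonneg (sub_nonneg.2 (max_le_max ?_ le_rfl)) (by positivity)
  linarith

lemma monotone_cutScale : Monotone cutScale :=
  monotone_of_hasDerivAt_nonneg hasDerivAt_cutScale cutScaleDeriv_nonneg

lemma monotone_sub_cutScale : Monotone fun y => y - cutScale y :=
  monotone_of_hasDerivAt_nonneg (fun y => (hasDerivAt_id y).sub (hasDerivAt_cutScale y))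
    fun y => sub_nonneg.2 (cutScaleDeriv_le_one y)

lemma cutScale_of_le {y : ℝ} (hy : y ≤ π) : cutScale y = y := by
  have hpi := Real.pi_pos
  simp [cutScale, posSq, max_eq_right (sub_nonpos.2 hy),
    max_eq_right (show y - 3 * π ≤ 0 by linarith)]

lemma cutScaleDeriv_of_le {y : ℝ} (hy : y ≤ π) : cutScaleDeriv y = 1 := by
  have hpi := Real.pi_pos
  simp [cutScaleDeriv, max_eq_right (sub_nonpos.2 hy),
    max_eq_right (show y - 3 * π ≤ 0 by linarith)]

lemma cutScale_of_ge {y : ℝ} (hy : 3 * π ≤ y) : cutScale y = 2 * π := by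
  have hpi := Real.pi_pos
  rw [cutScale, posSq, posSq, max_eq_left (sub_nonneg.2 hy),
    max_eq_left (show 0 ≤ y - π by linarith)]
  field_simp
  ring

lemma cutScale_pos {y : ℝ} (hy : 0 < y) : 0 < cutScale y := by
  rcases le_total y π with h | h
  · rwa [cutScale_of_le h]
  · exact Real.pi_pos.trans_le ((cutScale_of_le le_rfl).ge.trans (monotone_cutScale h))

lemma cutScale_le {y : ℝ} (hy : 0 ≤ y) : cutScale y ≤ y := by
  have h := monotone_sub_cutScale hy
  simp only [cutScale_of_le Real.pi_pos.le] at h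
  linarith

/-! ### Averages of an increasing function -/

/-- The average of `g` over the segment from `x` to `x + s`. -/
def avgFrom (g : ℝ → ℝ) (x s : ℝ) : ℝ := ∫ r in (0 : ℝ)..1, g (x + r * s)

section Average

variable {g : ℝ → ℝ}

lemma avgFrom_zero (x : ℝ) : avgFrom g x 0 = g x := by simp [avgFrom]

lemma continuous_avgFrom (hc : Continuous g) :
    Continuous fun p : ℝ × ℝ => avgFrom g p.1 p.2 := by
  unfold avgFrom
  refine intervalIntegral.continuous_parametric_intervalIntegral_of_continuous' ?_ 0 1
  fun_prop

lemma avgFrom_eq (hc : Continuous g) (x : ℝ) {s : ℝ} (hs : s ≠ 0) :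
    avgFrom g x s = ((∫ u in (0 : ℝ)..(x + s), g u) - ∫ u in (0 : ℝ)..x, g u) / s := by
  have h1 : ∫ r in (0 : ℝ)..1, g (x + r * s) = s⁻¹ • ∫ u in (x + 0 * s)..(x + 1 * s), g u := by
    have := intervalIntegral.integral_comp_add_mul (f := g) (a := 0) (b := 1) hs x
    simpa [mul_comm] using this
  rw [avgFrom, h1, intervalIntegral.integral_interval_sub_left (hc.intervalIntegrable _ _)
    (hc.intervalIntegrable _ _)]
  simp [div_eq_inv_mul]

lemma hasDerivAt_primitive (hc : Continuous g) (x : ℝ) :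
    HasDerivAt (fun x => ∫ u in (0 : ℝ)..x, g u) (g x) x :=
  intervalIntegral.integral_hasDerivAt_right (hc.intervalIntegrable _ _)
    (hc.stronglyMeasurableAtFilter _ _) hc.continuousAt

lemma contDiff_primitive (hc : Continuous g) : ContDiff ℝ 1 fun x => ∫ u in (0 : ℝ)..x, g u := by
  rw [contDiff_one_iff_deriv]
  refine ⟨fun y => (hasDerivAt_primitive hc y).differentiableAt, ?_⟩
  rwa [show deriv _ = g from funext fun y => (hasDerivAt_primitive hc y).deriv]

lemma avgFrom_eventuallyEq (hc : Continuous g) {p : ℝ × ℝ} (hp : p.2 ≠ 0) :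
    (fun p : ℝ × ℝ => avgFrom g p.1 p.2) =ᶠ[nhds p] fun p : ℝ × ℝ =>
      ((∫ u in (0 : ℝ)..(p.1 + p.2), g u) - ∫ u in (0 : ℝ)..p.1, g u) / p.2 := by
  filter_upwards [continuous_snd.continuousAt.eventually_ne hp] with z hz
  exact avgFrom_eq hc _ hz

lemma contDiffAt_avgFrom (hc : Continuous g) {p : ℝ × ℝ} (hp : p.2 ≠ 0) :
    ContDiffAt ℝ 1 (fun p : ℝ × ℝ => avgFrom g p.1 p.2) p := by
  refine ContDiffAt.congr_of_eventuallyEq ?_ (avgFrom_eventuallyEq hc hp)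
  have h := contDiff_primitive hc
  exact ((h.comp (contDiff_fst.add contDiff_snd)).sub (h.comp contDiff_fst)).contDiffAt.div
    contDiffAt_snd hp

lemma hasFDerivAt_avgFrom (hc : Continuous g) {x s : ℝ} (hs : s ≠ 0) :
    HasFDerivAt (fun p : ℝ × ℝ => avgFrom g p.1 p.2)
      (((g (x + s) - g x) / s) • ContinuousLinearMap.fst ℝ ℝ ℝ +
        ((g (x + s) - avgFrom g x s) / s) • ContinuousLinearMap.snd ℝ ℝ ℝ) (x, s) := by
  refine HasFDerivAt.congr_of_eventuallyEq ?_ (avgFrom_eventuallyEq hc hs)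
  have h1 : HasFDerivAt (fun p : ℝ × ℝ => p.1 + p.2)
      (ContinuousLinearMap.fst ℝ ℝ ℝ + ContinuousLinearMap.snd ℝ ℝ ℝ) (x, s) :=
    hasFDerivAt_fst.add hasFDerivAt_snd
  have h2 := (hasDerivAt_primitive hc (x + s)).comp_hasFDerivAt (x, s) h1
  have h3 := (hasDerivAt_primitive hc x).comp_hasFDerivAt (x, s)
    (hasFDerivAt_fst (𝕜 := ℝ) (E := ℝ) (F := ℝ))
  have h4 := (hasDerivAt_inv hs).comp_hasFDerivAt (x, s)
    (hasFDerivAt_snd (𝕜 := ℝ) (E := ℝ) (F := ℝ))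
  refine HasFDerivAt.congr_fderiv ((h2.sub h3).mul h4) ?_
  ext
  · simp
    field_simp
  · simp [avgFrom_eq hc x hs]
    field_simp
    ring

lemma intervalIntegrable_avg (hc : Continuous g) (x s a b : ℝ) :
    IntervalIntegrable (fun r => g (x + r * s)) volume a b :=
  Continuous.intervalIntegrable (by fun_prop) _ _

lemma avgFrom_lt_avgFrom (hm : StrictMono g) (hc : Continuous g) {x x' s s' : ℝ} (hx : x ≤ x')
    (hs : s ≤ s') (h : x < x' ∨ s < s') : avgFrom g x s < avgFrom g x' s' := by
  refine intervalIntegral.integral_lt_integral_of_continuousOn_of_le_of_exists_lt one_pos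
    (by fun_prop) (by fun_prop) (fun r hr => ?_) ⟨1, by simp, hm ?_⟩
  · exact hm.monotone (add_le_add hx (mul_le_mul_of_nonneg_left hs hr.1.le))
  · rcases h with h | h <;> linarith

lemma avgFrom_le_avgFrom (hm : StrictMono g) (hc : Continuous g) {x x' s s' : ℝ} (hx : x ≤ x')
    (hs : s ≤ s') : avgFrom g x s ≤ avgFrom g x' s' := by
  rcases hx.eq_or_lt with rfl | h
  · rcases hs.eq_or_lt with rfl | h
    · exact le_rfl
    · exact (avgFrom_lt_avgFrom hm hc le_rfl hs (Or.inr h)).le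
  · exact (avgFrom_lt_avgFrom hm hc hx hs (Or.inl h)).le

/-- Splitting the segment at the proportion `c` bounds the average from above. -/
lemma avgFrom_le_split (hm : StrictMono g) (hc : Continuous g) {x s c : ℝ} (hs : 0 ≤ s)
    (h0 : 0 ≤ c) (h1 : c ≤ 1) :
    avgFrom g x s ≤ c * g (x + c * s) + (1 - c) * g (x + s) := by
  have hi := intervalIntegrable_avg hc x s
  rw [avgFrom, ← intervalIntegral.integral_add_adjacent_intervals (hi 0 c) (hi c 1)]
  refine add_le_add ?_ ?_
  · have := intervalIntegral.integral_mono_on h0 (hi 0 c)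
      (intervalIntegrable_const (c := g (x + c * s))) fun r hr => hm.monotone
        (add_le_add le_rfl (mul_le_mul_of_nonneg_right hr.2 hs))
    simpa using this
  · have := intervalIntegral.integral_mono_on h1 (hi c 1)
      (intervalIntegrable_const (c := g (x + s))) fun r hr => hm.monotone
        (add_le_add le_rfl (mul_le_of_le_one_left hs hr.2))
    simpa using this

/-- Splitting the segment at the proportion `c` bounds the average from below. -/
lemma split_le_avgFrom (hm : StrictMono g) (hc : Continuous g) {x s c : ℝ} (hs : 0 ≤ s)
    (h0 : 0 ≤ c) (h1 : c ≤ 1) :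
    c * g (x - c * s) + (1 - c) * g (x - s) ≤ avgFrom g x (-s) := by
  have hi := intervalIntegrable_avg hc x (-s)
  rw [avgFrom, ← intervalIntegral.integral_add_adjacent_intervals (hi 0 c) (hi c 1)]
  refine add_le_add ?_ ?_
  · have := intervalIntegral.integral_mono_on h0
      (intervalIntegrable_const (c := g (x - c * s))) (hi 0 c) fun r hr => hm.monotone
        (by nlinarith [mul_le_mul_of_nonneg_right hr.2 hs])
    simpa using this
  · have := intervalIntegral.integral_mono_on h1
      (intervalIntegrable_const (c := g (x - s))) (hi c 1) fun r hr => hm.monotone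
        (by nlinarith [mul_le_of_le_one_left hs hr.2])
    simpa using this

lemma avgFrom_lt_right (hm : StrictMono g) (hc : Continuous g) (x : ℝ) {s : ℝ} (hs : 0 < s) :
    avgFrom g x s < g (x + s) := by
  have h := avgFrom_le_split hm hc (x := x) hs.le (c := 1 / 2) (by norm_num) (by norm_num)
  have := hm (show x + 1 / 2 * s < x + s by linarith)
  linarith

lemma left_lt_avgFrom (hm : StrictMono g) (hc : Continuous g) (x : ℝ) {s : ℝ} (hs : 0 < s) :
    g (x - s) < avgFrom g x (-s) := by
  have h := split_le_avgFrom hm hc (x := x) hs.le (c := 1 / 2) (by norm_num) (by norm_num)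
  have := hm (show x - s < x - 1 / 2 * s by linarith)
  linarith

lemma avgFrom_add_period (hc : Continuous g) (hp : ∀ θ, g (θ + 2 * π) = g θ + 2 * π) (x s : ℝ) :
    avgFrom g (x + 2 * π) s = avgFrom g x s + 2 * π := by
  have : ∀ r, g (x + 2 * π + r * s) = g (x + r * s) + 2 * π := fun r => by rw [← hp]; ring_nf
  simp only [avgFrom, this]
  rw [intervalIntegral.integral_add (intervalIntegrable_avg hc x s 0 1) (by simp)]
  simp

lemma avgFrom_period (hc : Continuous g) (hp : ∀ θ, g (θ + 2 * π) = g θ + 2 * π) (x : ℝ) :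
    avgFrom g x (2 * π) = x + avgFrom g 0 (2 * π) := by
  have hpi : 2 * π ≠ 0 := by positivity
  have hd : ∀ x, HasDerivAt (fun x => avgFrom g x (2 * π) - x) 0 x := fun x => by
    have h := (hasFDerivAt_avgFrom hc (x := x) hpi).comp_hasDerivAt x
      ((hasDerivAt_id x).prodMk (hasDerivAt_const x (2 * π)))
    refine HasDerivAt.congr_deriv (h.sub (hasDerivAt_id x)) ?_
    simp [hp]
  have := is_const_of_deriv_eq_zero (fun x => (hd x).differentiableAt) (fun x => (hd x).deriv) x 0
  linarith

lemma avgFrom_neg_period (hc : Continuous g) (hp : ∀ θ, g (θ + 2 * π) = g θ + 2 * π) (x : ℝ) :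
    avgFrom g x (-(2 * π)) = avgFrom g x (2 * π) - 2 * π := by
  have h := avgFrom_period hc hp (x - 2 * π)
  have hpi : 2 * π ≠ 0 := by positivity
  have h1 : avgFrom g x (-(2 * π)) = avgFrom g (x - 2 * π) (2 * π) := by
    rw [avgFrom_eq hc _ hpi, avgFrom_eq hc _ (neg_ne_zero.2 hpi), div_neg, ← neg_div, neg_sub]
    simp [sub_eq_add_neg]
  rw [h1, h, avgFrom_period hc hp x]
  ring

end Average

/-! ### Real-linear maps of the plane -/

lemma det_eq_re_im (L : ℂ →L[ℝ] ℂ) :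
    L.det = (L 1).re * (L Complex.I).im - (L Complex.I).re * (L 1).im := by
  rw [ContinuousLinearMap.det, ← LinearMap.det_toMatrix Complex.basisOneI, Matrix.det_fin_two]
  simp [LinearMap.toMatrix_apply]

lemma norm_le_norm_one_add_norm_I (L : ℂ →L[ℝ] ℂ) : ‖L‖ ≤ ‖L 1‖ + ‖L Complex.I‖ := by
  refine L.opNorm_le_bound (by positivity) fun z => ?_
  have hz : L z = z.re • L 1 + z.im • L Complex.I := by
    rw [← map_smul, ← map_smul, ← map_add]
    congr 1
    apply Complex.ext <;> simp
  rw [hz, add_mul]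
  refine (norm_add_le _ _).trans (add_le_add ?_ ?_) <;> rw [norm_smul, mul_comm]
  · exact mul_le_mul_of_nonneg_left (Complex.abs_re_le_norm z) (norm_nonneg _)
  · exact mul_le_mul_of_nonneg_left (Complex.abs_im_le_norm z) (norm_nonneg _)

/-! ### The extension in logarithmic coordinates -/

/-- The average of `g` to the right of `Im ζ` at scale `-Re ζ`, with a linear correction
far from the imaginary axis. -/
def rightMean (g : ℝ → ℝ) (ζ : ℂ) : ℝ :=
  avgFrom g ζ.im (cutScale (-ζ.re)) + (-ζ.re - cutScale (-ζ.re)) / 2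

/-- The average of `g` to the left of `Im ζ` at scale `-Re ζ`, with a linear correction
far from the imaginary axis. -/
def leftMean (g : ℝ → ℝ) (ζ : ℂ) : ℝ :=
  avgFrom g ζ.im (-cutScale (-ζ.re)) - (-ζ.re - cutScale (-ζ.re)) / 2

/-- The Beurling–Ahlfors extension of `g` from the imaginary axis to the left half-plane, modified
to be a translation far from the imaginary axis. -/
def logExt (g : ℝ → ℝ) (ζ : ℂ) : ℂ :=
  ((leftMean g ζ - rightMean g ζ : ℝ) : ℂ) +
    (((leftMean g ζ + rightMean g ζ) / 2 : ℝ) : ℂ) * Complex.I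

section LogExt

variable {g : ℝ → ℝ}

lemma logExt_re (ζ : ℂ) : (logExt g ζ).re = leftMean g ζ - rightMean g ζ := by simp [logExt]

lemma logExt_im (ζ : ℂ) : (logExt g ζ).im = (leftMean g ζ + rightMean g ζ) / 2 := by
  simp [logExt]

lemma continuous_logExt (hc : Continuous g) : Continuous (logExt g) := by
  have h1 : Continuous fun ζ : ℂ => cutScale (-ζ.re) :=
    contDiff_cutScale.continuous.comp Complex.continuous_re.neg
  have h2 : Continuous fun ζ : ℂ => avgFrom g ζ.im (cutScale (-ζ.re)) :=
    (continuous_avgFrom hc).comp (Complex.continuous_im.prodMk h1)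
  have h3 : Continuous fun ζ : ℂ => avgFrom g ζ.im (-cutScale (-ζ.re)) :=
    (continuous_avgFrom hc).comp (Complex.continuous_im.prodMk h1.neg)
  unfold logExt leftMean rightMean
  fun_prop

lemma contDiffAt_logExt (hc : Continuous g) {ζ : ℂ} (hζ : ζ.re < 0) :
    ContDiffAt ℝ 1 (logExt g) ζ := by
  have h0 : cutScale (-ζ.re) ≠ 0 := (cutScale_pos (neg_pos.2 hζ)).ne'
  have hre : ContDiff ℝ 1 fun ζ : ℂ => ζ.re := Complex.reCLM.contDiff
  have him : ContDiff ℝ 1 fun ζ : ℂ => ζ.im := Complex.imCLM.contDiff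
  have h1 : ContDiff ℝ 1 fun ζ : ℂ => cutScale (-ζ.re) := contDiff_cutScale.comp hre.neg
  have h2 : ContDiffAt ℝ 1 (fun ζ : ℂ => avgFrom g ζ.im (cutScale (-ζ.re))) ζ :=
    ContDiffAt.comp (f := fun ζ : ℂ => (ζ.im, cutScale (-ζ.re))) ζ (contDiffAt_avgFrom hc h0)
      (him.prodMk h1).contDiffAt
  have h3 : ContDiffAt ℝ 1 (fun ζ : ℂ => avgFrom g ζ.im (-cutScale (-ζ.re))) ζ :=
    ContDiffAt.comp (f := fun ζ : ℂ => (ζ.im, -cutScale (-ζ.re))) ζ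
      (contDiffAt_avgFrom hc (neg_ne_zero.2 h0)) (him.prodMk h1.neg).contDiffAt
  have h4 : ContDiffAt ℝ 1 (fun ζ : ℂ => (-ζ.re - cutScale (-ζ.re)) / 2) ζ :=
    ((hre.neg.sub h1).div_const 2).contDiffAt
  have h5 : ContDiffAt ℝ 1 (rightMean g) ζ := h2.add h4
  have h6 : ContDiffAt ℝ 1 (leftMean g) ζ := h3.sub h4
  have h7 := Complex.ofRealCLM.contDiff (n := 1)
  exact (h7.contDiffAt.comp ζ (h6.sub h5)).add
    ((h7.contDiffAt.comp ζ ((h6.add h5).div_const 2)).mul contDiffAt_const)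

lemma hasFDerivAt_cutScale_neg_re (ζ : ℂ) :
    HasFDerivAt (fun ζ : ℂ => cutScale (-ζ.re)) (-cutScaleDeriv (-ζ.re) • Complex.reCLM) ζ := by
  have h : HasFDerivAt (fun ζ : ℂ => -ζ.re) (-Complex.reCLM) ζ := Complex.reCLM.hasFDerivAt.neg
  have h' := (hasDerivAt_cutScale (-ζ.re)).comp_hasFDerivAt ζ h
  exact HasFDerivAt.congr_fderiv h' (by ext; simp)

lemma hasFDerivAt_rightMean (hc : Continuous g) {x y : ℝ} (hy : 0 < y) :
    HasFDerivAt (rightMean g)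
      (((g (x + cutScale y) - g x) / cutScale y) • Complex.imCLM -
        ((g (x + cutScale y) - avgFrom g x (cutScale y)) / cutScale y * cutScaleDeriv y +
          (1 - cutScaleDeriv y) / 2) • Complex.reCLM) (⟨-y, x⟩ : ℂ) := by
  have h0 : cutScale y ≠ 0 := (cutScale_pos hy).ne'
  have h1 := hasFDerivAt_cutScale_neg_re ⟨-y, x⟩
  have h2 : HasFDerivAt (fun ζ : ℂ => ζ.im) Complex.imCLM ⟨-y, x⟩ := Complex.imCLM.hasFDerivAt
  have h3 : HasFDerivAt (fun ζ : ℂ => -ζ.re) (-Complex.reCLM) ⟨-y, x⟩ :=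
    Complex.reCLM.hasFDerivAt.neg
  have h4 := HasFDerivAt.comp (f := fun ζ : ℂ => (ζ.im, cutScale (-ζ.re))) (⟨-y, x⟩ : ℂ)
    (by simpa using hasFDerivAt_avgFrom hc (x := x) h0) (h2.prodMk h1)
  refine HasFDerivAt.congr_fderiv (h4.add ((h3.sub h1).const_mul (1 / 2))) ?_
    |>.congr_of_eventuallyEq (Filter.Eventually.of_forall fun ζ => ?_)
  · ext
    simp
    ring
  · simp [rightMean]
    ring

lemma hasFDerivAt_leftMean (hc : Continuous g) {x y : ℝ} (hy : 0 < y) :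
    HasFDerivAt (leftMean g)
      (((g x - g (x - cutScale y)) / cutScale y) • Complex.imCLM +
        ((avgFrom g x (-cutScale y) - g (x - cutScale y)) / cutScale y * cutScaleDeriv y +
          (1 - cutScaleDeriv y) / 2) • Complex.reCLM) (⟨-y, x⟩ : ℂ) := by
  have h0 : cutScale y ≠ 0 := (cutScale_pos hy).ne'
  have h1 := hasFDerivAt_cutScale_neg_re ⟨-y, x⟩
  have h2 : HasFDerivAt (fun ζ : ℂ => ζ.im) Complex.imCLM ⟨-y, x⟩ := Complex.imCLM.hasFDerivAt
  have h3 : HasFDerivAt (fun ζ : ℂ => -ζ.re) (-Complex.reCLM) ⟨-y, x⟩ :=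
    Complex.reCLM.hasFDerivAt.neg
  have h4 := HasFDerivAt.comp (f := fun ζ : ℂ => (ζ.im, -cutScale (-ζ.re))) (⟨-y, x⟩ : ℂ)
    (by simpa using hasFDerivAt_avgFrom hc (x := x) (neg_ne_zero.2 h0)) (h2.prodMk h1.neg)
  refine HasFDerivAt.congr_fderiv (h4.sub ((h3.sub h1).const_mul (1 / 2))) ?_
    |>.congr_of_eventuallyEq (Filter.Eventually.of_forall fun ζ => ?_)
  · ext
    simp [div_neg, ← sub_eq_add_neg]
    ring
  · simp [leftMean]
    ring

lemma fderiv_logExt {ζ : ℂ} {ax ay bx b_y : ℝ}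
    (hr : HasFDerivAt (rightMean g) (ax • Complex.imCLM - ay • Complex.reCLM) ζ)
    (hl : HasFDerivAt (leftMean g) (bx • Complex.imCLM + b_y • Complex.reCLM) ζ) :
    fderiv ℝ (logExt g) ζ 1 = ⟨b_y + ay, (b_y - ay) / 2⟩ ∧
      fderiv ℝ (logExt g) ζ Complex.I = ⟨bx - ax, (bx + ax) / 2⟩ := by
  have h1 := Complex.ofRealCLM.hasFDerivAt.comp ζ (hl.sub hr)
  have h2 := Complex.ofRealCLM.hasFDerivAt.comp ζ ((hl.add hr).mul_const (1 / 2))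
  have h3 : HasFDerivAt (logExt g) _ ζ :=
    (h1.add (h2.mul_const Complex.I)).congr_of_eventuallyEq
      (Filter.Eventually.of_forall fun z => by simp [logExt, div_eq_mul_inv])
  rw [h3.fderiv]
  constructor <;> apply Complex.ext <;> simp <;> ring

/-- The partial derivatives of `rightMean` and `leftMean` have the expected signs. -/
lemma det_fderiv_logExt_pos (hm : StrictMono g) (hc : Continuous g) {ζ : ℂ} (hζ : ζ.re < 0) :
    0 < (fderiv ℝ (logExt g) ζ).det := by
  obtain ⟨x, y, hy, rfl⟩ : ∃ x y : ℝ, 0 < y ∧ ζ = ⟨-y, x⟩ :=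
    ⟨ζ.im, -ζ.re, neg_pos.2 hζ, by simp⟩
  obtain ⟨h1, h2⟩ := fderiv_logExt (hasFDerivAt_rightMean hc hy) (hasFDerivAt_leftMean hc hy)
  have hs := cutScale_pos hy
  have hax : 0 < (g (x + cutScale y) - g x) / cutScale y :=
    div_pos (sub_pos.2 (hm (by linarith))) hs
  have hbx : 0 < (g x - g (x - cutScale y)) / cutScale y :=
    div_pos (sub_pos.2 (hm (by linarith))) hs
  have h3 := div_pos (sub_pos.2 (avgFrom_lt_right hm hc x hs)) hs
  have h4 := div_pos (sub_pos.2 (left_lt_avgFrom hm hc x hs)) hs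
  have key : ∀ c, 0 < c → 0 < c * cutScaleDeriv y + (1 - cutScaleDeriv y) / 2 := fun c hc' => by
    have h5 := cutScaleDeriv_nonneg y
    rcases (cutScaleDeriv_le_one y).eq_or_lt with h6 | h6
    · rw [h6]; simpa
    · have := mul_nonneg hc'.le h5
      linarith
  have hay := key _ h3
  have hby := key _ h4
  rw [det_eq_re_im, h1, h2]
  have := mul_pos hay hbx
  have := mul_pos hby hax
  linarith

/-- The symmetric distortion of an increasing function. -/
def symRatio (g : ℝ → ℝ) (x t : ℝ) : ℝ :=
  max ((g (x + t) - g x) / (g x - g (x - t))) ((g x - g (x - t)) / (g (x + t) - g x))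

lemma right_le_symRatio_mul (hm : StrictMono g) (x : ℝ) {t : ℝ} (ht : 0 < t) :
    g (x + t) - g x ≤ symRatio g x t * (g x - g (x - t)) :=
  (div_le_iff₀ (sub_pos.2 (hm (by linarith)))).1 (le_max_left _ _)

lemma left_le_symRatio_mul (hm : StrictMono g) (x : ℝ) {t : ℝ} (ht : 0 < t) :
    g x - g (x - t) ≤ symRatio g x t * (g (x + t) - g x) :=
  (div_le_iff₀ (sub_pos.2 (hm (by linarith)))).1 (le_max_right _ _)

lemma sq_add_le_of_le {a b a' b' R : ℝ} (hb : 0 < b) (ha' : 0 ≤ a') (hb' : 0 ≤ b')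
    (hba : b ≤ a) (hR : 0 < R) (h : a ≤ R * b) (h' : a / 4 ≤ a' ∨ a ≤ 8 * R * b') :
    (3 * (a + b)) ^ 2 ≤ 288 * R * (a' * b + b' * a) := by
  have ha := hb.trans_le hba
  have h1 : (3 * (a + b)) ^ 2 ≤ 36 * a * a := by nlinarith
  have h2 : 0 ≤ R * (a' * b) := by positivity
  have h3 : 0 ≤ R * (b' * a) := by positivity
  rcases h' with h' | h'
  · have h4 := mul_le_mul h h' (by positivity) (by positivity)
    nlinarith
  · have h4 := mul_le_mul_of_nonneg_right h' ha.le
    nlinarith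

/-- The three symmetric distortions that control the dilatation of the extension at height `y`
above `x`. -/
def maxRatio (g : ℝ → ℝ) (x y : ℝ) : ℝ :=
  max (symRatio g x y)
    (max (symRatio g (x - y / 4) (3 * y / 4)) (symRatio g (x + y / 4) (3 * y / 4)))

lemma sq_add_le_maxRatio_mul (hm : StrictMono g) (hc : Continuous g) (x : ℝ) {y : ℝ} (hy : 0 < y) :
    (3 * ((g (x + y) - g x) + (g x - g (x - y)))) ^ 2 ≤ 288 * maxRatio g x y *
      ((g (x + y) - avgFrom g x y) * (g x - g (x - y)) +
        (avgFrom g x (-y) - g (x - y)) * (g (x + y) - g x)) := by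
  have ha : 0 < g (x + y) - g x := sub_pos.2 (hm (by linarith))
  have hb : 0 < g x - g (x - y) := sub_pos.2 (hm (by linarith))
  have ha' := sub_pos.2 (avgFrom_lt_right hm hc x hy)
  have hb' := sub_pos.2 (left_lt_avgFrom hm hc x hy)
  have hy4 : 0 < 3 * y / 4 := by linarith
  have hR1 : symRatio g x y ≤ maxRatio g x y := le_max_left _ _
  have hR2 : symRatio g (x - y / 4) (3 * y / 4) ≤ maxRatio g x y :=
    (le_max_left _ _).trans (le_max_right _ _)
  have hR3 : symRatio g (x + y / 4) (3 * y / 4) ≤ maxRatio g x y :=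
    (le_max_right _ _).trans (le_max_right _ _)
  have hR : 0 < maxRatio g x y := ((div_pos ha hb).trans_le (le_max_left _ _)).trans_le hR1
  have r1 := right_le_symRatio_mul hm x hy
  have l1 := left_le_symRatio_mul hm x hy
  have r2 := right_le_symRatio_mul hm (x - y / 4) hy4
  have l3 := left_le_symRatio_mul hm (x + y / 4) hy4
  rw [show x - y / 4 + 3 * y / 4 = x + y / 2 by ring,
    show x - y / 4 - 3 * y / 4 = x - y by ring] at r2
  rw [show x + y / 4 + 3 * y / 4 = x + y by ring,
    show x + y / 4 - 3 * y / 4 = x - y / 2 by ring] at l3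
  have s1 := avgFrom_le_split hm hc (x := x) hy.le (c := 1 / 2) (by norm_num) (by norm_num)
  have s2 := avgFrom_le_split hm hc (x := x) hy.le (c := 1 / 4) (by norm_num) (by norm_num)
  have s3 := split_le_avgFrom hm hc (x := x) hy.le (c := 1 / 2) (by norm_num) (by norm_num)
  have s4 := split_le_avgFrom hm hc (x := x) hy.le (c := 1 / 4) (by norm_num) (by norm_num)
  rw [show x + 1 / 2 * y = x + y / 2 by ring] at s1
  rw [show x + 1 / 4 * y = x + y / 4 by ring] at s2
  rw [show x - 1 / 2 * y = x - y / 2 by ring] at s3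
  rw [show x - 1 / 4 * y = x - y / 4 by ring] at s4
  have m1 : g (x - y / 4) ≤ g x := hm.monotone (by linarith)
  have m2 : g x ≤ g (x + y / 4) := hm.monotone (by linarith)
  rcases le_total (g x - g (x - y)) (g (x + y) - g x) with hab | hab
  · refine sq_add_le_of_le hb ha'.le hb'.le hab hR
      (r1.trans (mul_le_mul_of_nonneg_right hR1 hb.le)) ?_
    by_cases hhalf : (g (x + y) - g x) / 2 ≤ g (x + y) - g (x + y / 2)
    · left; linarith
    · right
      have := mul_le_mul_of_nonneg_right hR2
        (sub_nonneg.2 (hm.monotone (show x - y ≤ x - y / 4 by linarith)))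
      have := mul_le_mul_of_nonneg_left s4 hR.le
      linarith
  · have h := sq_add_le_of_le ha hb'.le ha'.le hab hR
      (l1.trans (mul_le_mul_of_nonneg_right hR1 ha.le)) ?_
    · calc _ = _ := by rw [add_comm (g (x + y) - g x)]
        _ ≤ _ := h
        _ = _ := by ring
    · by_cases hhalf : (g x - g (x - y)) / 2 ≤ g (x - y / 2) - g (x - y)
      · left; linarith
      · right
        have := mul_le_mul_of_nonneg_right hR3
          (sub_nonneg.2 (hm.monotone (show x + y / 4 ≤ x + y by linarith)))
        have := mul_le_mul_of_nonneg_left s2 hR.le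
        linarith

lemma norm_add_norm_le_of_le {a b a' b' : ℝ} (ha' : 0 ≤ a') (ha : a' ≤ a) (hb' : 0 ≤ b')
    (hb : b' ≤ b) :
    ‖(⟨b' + a', (b' - a') / 2⟩ : ℂ)‖ + ‖(⟨b - a, (b + a) / 2⟩ : ℂ)‖ ≤ 3 * (a + b) := by
  have e1 := Complex.norm_le_abs_re_add_abs_im (⟨b' + a', (b' - a') / 2⟩ : ℂ)
  have e2 := Complex.norm_le_abs_re_add_abs_im (⟨b - a, (b + a) / 2⟩ : ℂ)
  have d1 : |b' + a'| ≤ a + b := abs_le.2 ⟨by linarith, by linarith⟩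
  have d2 : |(b' - a') / 2| ≤ (a + b) / 2 := abs_le.2 ⟨by linarith, by linarith⟩
  have d3 : |b - a| ≤ a + b := abs_le.2 ⟨by linarith, by linarith⟩
  have d4 : |(b + a) / 2| ≤ (a + b) / 2 := abs_le.2 ⟨by linarith, by linarith⟩
  simp only at e1 e2
  linarith

/-- The dilatation of the extension is linearly bounded by symmetric distortions of `g`. -/
lemma dilC_logExt_le (hm : StrictMono g) (hc : Continuous g) {ζ : ℂ} (hζ : ζ.re < 0)
    (hζ' : -π ≤ ζ.re) : dilC (logExt g) ζ ≤ 288 * maxRatio g ζ.im (-ζ.re) := by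
  obtain ⟨x, y, hy, rfl⟩ : ∃ x y : ℝ, 0 < y ∧ ζ = ⟨-y, x⟩ :=
    ⟨ζ.im, -ζ.re, neg_pos.2 hζ, by simp⟩
  have hyπ : y ≤ π := by simpa using hζ'
  obtain ⟨h1, h2⟩ := fderiv_logExt (hasFDerivAt_rightMean hc hy) (hasFDerivAt_leftMean hc hy)
  rw [dilC, div_le_iff₀ (det_fderiv_logExt_pos hm hc hζ)]
  have hnorm := norm_le_norm_one_add_norm_I (fderiv ℝ (logExt g) ⟨-y, x⟩)
  simp only [cutScale_of_le hyπ, cutScaleDeriv_of_le hyπ, mul_one, sub_self, zero_div,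
    add_zero] at h1 h2
  rw [det_eq_re_im]
  rw [h1, h2] at hnorm ⊢
  clear h1 h2
  have ha : 0 < g (x + y) - g x := sub_pos.2 (hm (by linarith))
  have hb : 0 < g x - g (x - y) := sub_pos.2 (hm (by linarith))
  have ha' := sub_pos.2 (avgFrom_lt_right hm hc x hy)
  have hb' := sub_pos.2 (left_lt_avgFrom hm hc x hy)
  have ha'' : g (x + y) - avgFrom g x y ≤ g (x + y) - g x := by
    have := avgFrom_le_avgFrom hm hc (le_refl x) hy.le
    rw [avgFrom_zero] at this
    linarith
  have hb'' : avgFrom g x (-y) - g (x - y) ≤ g x - g (x - y) := by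
    have := avgFrom_le_avgFrom hm hc (le_refl x) (neg_nonpos.2 hy.le)
    rw [avgFrom_zero] at this
    linarith
  have key := sq_add_le_maxRatio_mul hm hc x hy
  simp only [neg_neg]
  generalize g (x + y) - g x = a at *
  generalize g x - g (x - y) = b at *
  generalize g (x + y) - avgFrom g x y = a' at *
  generalize avgFrom g x (-y) - g (x - y) = b' at *
  have n1 : ‖fderiv ℝ (logExt g) ⟨-y, x⟩‖ ≤ 3 * (a + b) / y := by
    refine hnorm.trans ?_
    rw [show 3 * (a + b) / y = 3 * (a / y + b / y) by ring]
    exact norm_add_norm_le_of_le (show 0 ≤ a' / y by positivity)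
      (show a' / y ≤ a / y by gcongr) (show 0 ≤ b' / y by positivity)
      (show b' / y ≤ b / y by gcongr)
  calc _ ≤ (3 * (a + b) / y) ^ 2 := by gcongr
    _ = (3 * (a + b)) ^ 2 / y ^ 2 := by rw [div_pow]
    _ ≤ _ := div_le_div_of_nonneg_right key (by positivity)
    _ = _ := by field_simp; ring

lemma rightMean_lt (hm : StrictMono g) (hc : Continuous g) {z w : ℂ} (hx : z.im ≤ w.im)
    (hy : w.re ≤ z.re) (h : z ≠ w) : rightMean g z < rightMean g w := by
  have h1 := monotone_cutScale (neg_le_neg hy)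
  have h2 := monotone_sub_cutScale (neg_le_neg hy)
  simp only at h2
  unfold rightMean
  by_cases h3 : z.im < w.im ∨ cutScale (-z.re) < cutScale (-w.re)
  · have := avgFrom_lt_avgFrom hm hc hx h1 h3
    linarith
  · push Not at h3
    have h4 := avgFrom_le_avgFrom hm hc hx h1
    have h5 : z.re ≠ w.re := fun h5 => h (Complex.ext h5 (le_antisymm hx h3.1))
    have h6 := lt_of_le_of_ne hy h5.symm
    linarith

lemma leftMean_lt (hm : StrictMono g) (hc : Continuous g) {z w : ℂ} (hx : z.im ≤ w.im)
    (hy : z.re ≤ w.re) (h : z ≠ w) : leftMean g z < leftMean g w := by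
  have h1 := monotone_cutScale (neg_le_neg hy)
  have h2 := monotone_sub_cutScale (neg_le_neg hy)
  simp only at h2
  unfold leftMean
  by_cases h3 : z.im < w.im ∨ -cutScale (-z.re) < -cutScale (-w.re)
  · have := avgFrom_lt_avgFrom hm hc hx (neg_le_neg h1) h3
    linarith
  · push Not at h3
    have h4 := avgFrom_le_avgFrom hm hc hx (neg_le_neg h1)
    have h5 : z.re ≠ w.re := fun h5 => h (Complex.ext h5 (le_antisymm hx h3.1))
    have h6 := lt_of_le_of_ne hy h5
    linarith

lemma injective_logExt (hm : StrictMono g) (hc : Continuous g) : Injective (logExt g) := by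
  have key : ∀ z w : ℂ, z.im ≤ w.im → logExt g z = logExt g w → z = w := fun z w hx h => by
    by_contra hne
    have hre := congrArg Complex.re h
    have him := congrArg Complex.im h
    rw [logExt_re, logExt_re] at hre
    rw [logExt_im, logExt_im] at him
    rcases le_total z.re w.re with hy | hy
    · have := leftMean_lt hm hc hx hy hne
      linarith
    · have := rightMean_lt hm hc hx hy hne
      linarith
  intro z w h
  rcases le_total z.im w.im with hx | hx
  · exact key z w hx h
  · exact (key w z hx h.symm).symm

lemma logExt_of_re_eq_zero {ζ : ℂ} (hζ : ζ.re = 0) : logExt g ζ = g ζ.im * Complex.I := by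
  have h : cutScale 0 = 0 := cutScale_of_le Real.pi_pos.le
  simp [logExt, leftMean, rightMean, hζ, h, avgFrom_zero]

lemma logExt_re_neg (hm : StrictMono g) (hc : Continuous g) {ζ : ℂ} (hζ : ζ.re < 0) :
    (logExt g ζ).re < 0 := by
  have h1 := cutScale_pos (neg_pos.2 hζ)
  have h2 := cutScale_le (neg_nonneg.2 hζ.le)
  have h3 := avgFrom_lt_avgFrom hm hc (le_refl ζ.im)
    (show -cutScale (-ζ.re) ≤ cutScale (-ζ.re) by linarith) (Or.inr (by linarith))
  rw [logExt_re, leftMean, rightMean]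
  linarith

lemma logExt_of_re_le (hc : Continuous g) (hp : ∀ θ, g (θ + 2 * π) = g θ + 2 * π) {ζ : ℂ}
    (hζ : ζ.re ≤ -(3 * π)) :
    logExt g ζ = ζ + ((avgFrom g 0 (2 * π) - π : ℝ) : ℂ) * Complex.I := by
  have h := avgFrom_period hc hp ζ.im
  have h' := avgFrom_neg_period hc hp ζ.im
  have h1 := cutScale_of_ge (y := -ζ.re) (by linarith)
  apply Complex.ext
  · simp [logExt_re, leftMean, rightMean, h1, h', h]
    ring
  · simp [logExt_im, leftMean, rightMean, h1, h', h]
    ring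

lemma logExt_add_period (hc : Continuous g) (hp : ∀ θ, g (θ + 2 * π) = g θ + 2 * π) (ζ : ℂ) :
    logExt g (ζ + 2 * π * Complex.I) = logExt g ζ + 2 * π * Complex.I := by
  apply Complex.ext
  · simp [logExt_re, leftMean, rightMean, avgFrom_add_period hc hp]
    ring
  · simp [logExt_im, leftMean, rightMean, avgFrom_add_period hc hp]
    ring

lemma logExt_add_int_mul_period (hc : Continuous g) (hp : ∀ θ, g (θ + 2 * π) = g θ + 2 * π)
    (ζ : ℂ) (n : ℤ) :
    logExt g (ζ + n * (2 * π * Complex.I)) = logExt g ζ + n * (2 * π * Complex.I) := by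
  have h : Periodic (fun ζ => logExt g ζ - ζ) (2 * π * Complex.I) := fun ζ => by
    simp only [logExt_add_period hc hp]
    ring
  have := h.int_mul n ζ
  linear_combination this

end LogExt

/-! ### The extension in the disk -/

/-- The extension in the disk, obtained from `logExt` by conjugation with the exponential. -/
def diskExt (g : ℝ → ℝ) (w : ℂ) : ℂ :=
  if w = 0 then 0 else Complex.exp (logExt g (Complex.log w))

lemma det_smul_one (c : ℂ) : (c • (1 : ℂ →L[ℝ] ℂ)).det = ‖c‖ ^ 2 := by
  rw [det_eq_re_im, ← Complex.normSq_eq_norm_sq, Complex.normSq_apply]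
  simp

lemma det_smul_comp_smul (c d : ℂ) (L : ℂ →L[ℝ] ℂ) :
    ((c • (1 : ℂ →L[ℝ] ℂ)).comp (L.comp (d • (1 : ℂ →L[ℝ] ℂ)))).det =
      ‖c‖ ^ 2 * ‖d‖ ^ 2 * L.det := by
  have h' : ∀ L M : ℂ →L[ℝ] ℂ, (L.comp M).det = L.det * M.det := fun L M =>
    LinearMap.det_comp (L : ℂ →ₗ[ℝ] ℂ) (M : ℂ →ₗ[ℝ] ℂ)
  rw [h', h', det_smul_one, det_smul_one]
  ring

lemma norm_smul_comp_smul_le (c d : ℂ) (L : ℂ →L[ℝ] ℂ) :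
    ‖(c • (1 : ℂ →L[ℝ] ℂ)).comp (L.comp (d • (1 : ℂ →L[ℝ] ℂ)))‖ ≤ ‖c‖ * ‖d‖ * ‖L‖ := by
  refine ContinuousLinearMap.opNorm_le_bound _ (by positivity) fun z => ?_
  have := L.le_opNorm (d * z)
  rw [norm_mul] at this
  have := mul_le_mul_of_nonneg_left this (norm_nonneg c)
  calc _ = ‖c‖ * ‖L (d * z)‖ := by simp
    _ ≤ _ := this
    _ = _ := by ring

section DiskExt

variable {g : ℝ → ℝ}

lemma diskExt_zero : diskExt g 0 = 0 := if_pos rfl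

lemma diskExt_exp (hc : Continuous g) (hp : ∀ θ, g (θ + 2 * π) = g θ + 2 * π) (ζ : ℂ) :
    diskExt g (Complex.exp ζ) = Complex.exp (logExt g ζ) := by
  rw [diskExt, if_neg (Complex.exp_ne_zero ζ)]
  obtain ⟨n, hn⟩ := Complex.exp_eq_exp_iff_exists_int.1
    (Complex.exp_log (Complex.exp_ne_zero ζ))
  rw [hn, logExt_add_int_mul_period hc hp]
  exact Complex.exp_eq_exp_iff_exists_int.2 ⟨n, rfl⟩

lemma injective_diskExt (hm : StrictMono g) (hc : Continuous g)
    (hp : ∀ θ, g (θ + 2 * π) = g θ + 2 * π) : Injective (diskExt g) := by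
  intro z w h
  by_cases hz : z = 0 <;> by_cases hw : w = 0
  · rw [hz, hw]
  · rw [hz, diskExt_zero, diskExt, if_neg hw] at h
    exact absurd h.symm (Complex.exp_ne_zero _)
  · rw [hw, diskExt_zero, diskExt, if_neg hz] at h
    exact absurd h (Complex.exp_ne_zero _)
  · rw [diskExt, if_neg hz, diskExt, if_neg hw] at h
    obtain ⟨n, hn⟩ := Complex.exp_eq_exp_iff_exists_int.1 h
    rw [← logExt_add_int_mul_period hc hp] at hn
    rw [← Complex.exp_log hz, ← Complex.exp_log hw]
    exact Complex.exp_eq_exp_iff_exists_int.2 ⟨n, injective_logExt hm hc hn⟩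

lemma diskExt_eventuallyEq_branch (hc : Continuous g) (hp : ∀ θ, g (θ + 2 * π) = g θ + 2 * π)
    {w₀ : ℂ} (hw₀ : w₀ ≠ 0) :
    diskExt g =ᶠ[nhds w₀]
      fun w => Complex.exp (logExt g (Complex.log (w / w₀) + Complex.log w₀)) := by
  filter_upwards [eventually_ne_nhds hw₀] with w hw
  rw [← diskExt_exp hc hp, Complex.exp_add, Complex.exp_log (div_ne_zero hw hw₀),
    Complex.exp_log hw₀, div_mul_cancel₀ _ hw₀]

lemma diskExt_eventuallyEq_mul (hc : Continuous g) (hp : ∀ θ, g (θ + 2 * π) = g θ + 2 * π) :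
    diskExt g =ᶠ[nhds 0]
      fun w => w * Complex.exp (((avgFrom g 0 (2 * π) - π : ℝ) : ℂ) * Complex.I) := by
  filter_upwards [Metric.ball_mem_nhds (0 : ℂ) (Real.exp_pos (-(3 * π)))] with w hw
  by_cases h : w = 0
  · simp [h, diskExt_zero]
  · rw [diskExt, if_neg h, logExt_of_re_le hc hp, Complex.exp_add, Complex.exp_log h]
    rw [Complex.log_re, Real.log_le_iff_le_exp (norm_pos_iff.2 h)]
    exact (mem_ball_zero_iff.1 hw).le

lemma hasDerivAt_log_branch {w₀ : ℂ} (hw₀ : w₀ ≠ 0) :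
    HasDerivAt (fun w => Complex.log (w / w₀) + Complex.log w₀) w₀⁻¹ w₀ := by
  have h : w₀ / w₀ ∈ Complex.slitPlane := by simp [hw₀]
  have h' := (((hasDerivAt_id w₀).div_const w₀).clog h).add_const (Complex.log w₀)
  exact h'.congr_deriv (by simp [hw₀])

lemma continuous_diskExt (hc : Continuous g) (hp : ∀ θ, g (θ + 2 * π) = g θ + 2 * π) :
    Continuous (diskExt g) := by
  refine continuous_iff_continuousAt.2 fun w₀ => ?_
  by_cases hw₀ : w₀ = 0
  · rw [hw₀, continuousAt_congr (diskExt_eventuallyEq_mul hc hp)]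
    fun_prop
  · rw [continuousAt_congr (diskExt_eventuallyEq_branch hc hp hw₀)]
    exact Complex.continuous_exp.continuousAt.comp ((continuous_logExt hc).continuousAt.comp
      (hasDerivAt_log_branch hw₀).continuousAt)

lemma log_re_neg {w : ℂ} (hw : w ≠ 0) (hw' : ‖w‖ < 1) : (Complex.log w).re < 0 := by
  rw [Complex.log_re]
  exact Real.log_neg (norm_pos_iff.2 hw) hw'

lemma contDiffAt_diskExt (hc : Continuous g) (hp : ∀ θ, g (θ + 2 * π) = g θ + 2 * π) {w₀ : ℂ}
    (hw : ‖w₀‖ < 1) : ContDiffAt ℝ 1 (diskExt g) w₀ := by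
  by_cases hw₀ : w₀ = 0
  · rw [hw₀]
    refine ContDiffAt.congr_of_eventuallyEq ?_ (diskExt_eventuallyEq_mul hc hp)
    exact contDiffAt_id.mul contDiffAt_const
  · refine ContDiffAt.congr_of_eventuallyEq ?_ (diskExt_eventuallyEq_branch hc hp hw₀)
    have h : w₀ / w₀ ∈ Complex.slitPlane := by simp [hw₀]
    have h1 : ContDiffAt ℝ 1 (fun w => Complex.log (w / w₀) + Complex.log w₀) w₀ :=
      (ContDiffAt.comp w₀ ((Complex.contDiffAt_log h).restrict_scalars ℝ)
        (f := fun w => w / w₀) (contDiffAt_id.div_const w₀)).add contDiffAt_const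
    have h2 : ContDiffAt ℝ 1 (logExt g) (Complex.log (w₀ / w₀) + Complex.log w₀) :=
      contDiffAt_logExt hc (by simpa [hw₀] using log_re_neg hw₀ hw)
    have h3 : ContDiffAt ℝ 1 Complex.exp (logExt g (Complex.log (w₀ / w₀) + Complex.log w₀)) :=
      Complex.contDiff_exp.contDiffAt
    have h4 := ContDiffAt.comp w₀ (f := fun w => Complex.log (w / w₀) + Complex.log w₀) h2 h1
    exact ContDiffAt.comp w₀ (f := logExt g ∘ fun w => Complex.log (w / w₀) + Complex.log w₀) h3 h4

lemma fderiv_diskExt (hc : Continuous g) (hp : ∀ θ, g (θ + 2 * π) = g θ + 2 * π) {w₀ : ℂ}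
    (hw₀ : w₀ ≠ 0) (hw : ‖w₀‖ < 1) :
    fderiv ℝ (diskExt g) w₀ =
      (Complex.exp (logExt g (Complex.log w₀)) • (1 : ℂ →L[ℝ] ℂ)).comp
        ((fderiv ℝ (logExt g) (Complex.log w₀)).comp (w₀⁻¹ • (1 : ℂ →L[ℝ] ℂ))) := by
  rw [(diskExt_eventuallyEq_branch hc hp hw₀).fderiv_eq]
  have h0 : Complex.log (w₀ / w₀) + Complex.log w₀ = Complex.log w₀ := by simp [hw₀]
  have h1 := (hasDerivAt_log_branch hw₀).complexToReal_fderiv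
  have h2 : HasFDerivAt (logExt g) (fderiv ℝ (logExt g) (Complex.log w₀))
      (Complex.log (w₀ / w₀) + Complex.log w₀) := by
    rw [h0]
    exact ((contDiffAt_logExt hc (log_re_neg hw₀ hw)).differentiableAt one_ne_zero).hasFDerivAt
  have h3 := (Complex.hasDerivAt_exp
    (logExt g (Complex.log (w₀ / w₀) + Complex.log w₀))).complexToReal_fderiv
  have h4 := (HasFDerivAt.comp w₀ h3 (HasFDerivAt.comp w₀ h2 h1)).fderiv
  rw [h0] at h4
  exact h4

lemma det_fderiv_diskExt_pos (hm : StrictMono g) (hc : Continuous g)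
    (hp : ∀ θ, g (θ + 2 * π) = g θ + 2 * π) {w₀ : ℂ} (hw : ‖w₀‖ < 1) :
    0 < (fderiv ℝ (diskExt g) w₀).det := by
  by_cases hw₀ : w₀ = 0
  · rw [hw₀, (diskExt_eventuallyEq_mul hc hp).fderiv_eq]
    set c := Complex.exp (((avgFrom g 0 (2 * π) - π : ℝ) : ℂ) * Complex.I)
    have h1 : HasFDerivAt (fun w : ℂ => w * c) (c • (1 : ℂ →L[ℝ] ℂ)) 0 := by
      simpa using ((hasDerivAt_id (0 : ℂ)).mul_const c).complexToReal_fderiv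
    rw [h1.fderiv, det_smul_one]
    have : 0 < ‖c‖ := norm_pos_iff.2 (Complex.exp_ne_zero _)
    positivity
  · rw [fderiv_diskExt hc hp hw₀ hw, det_smul_comp_smul]
    have := det_fderiv_logExt_pos hm hc (log_re_neg hw₀ hw)
    have := norm_pos_iff.2 (Complex.exp_ne_zero (logExt g (Complex.log w₀)))
    have := norm_pos_iff.2 (inv_ne_zero hw₀)
    positivity

lemma dilC_diskExt_le (hm : StrictMono g) (hc : Continuous g)
    (hp : ∀ θ, g (θ + 2 * π) = g θ + 2 * π) {w₀ : ℂ} (hw₀ : w₀ ≠ 0) (hw : ‖w₀‖ < 1) :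
    dilC (diskExt g) w₀ ≤ dilC (logExt g) (Complex.log w₀) := by
  have h1 := det_fderiv_logExt_pos hm hc (log_re_neg hw₀ hw)
  have h2 := norm_pos_iff.2 (Complex.exp_ne_zero (logExt g (Complex.log w₀)))
  have h3 := norm_pos_iff.2 (inv_ne_zero hw₀)
  rw [dilC, dilC, fderiv_diskExt hc hp hw₀ hw, det_smul_comp_smul,
    div_le_div_iff₀ (by positivity) h1]
  calc _ ≤ (_ * _ * _) ^ 2 * _ :=
        mul_le_mul_of_nonneg_right (pow_le_pow_left₀ (norm_nonneg _)
          (norm_smul_comp_smul_le _ _ _) 2) h1.le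
    _ = _ := by ring

lemma norm_diskExt_lt_one (hm : StrictMono g) (hc : Continuous g) {w : ℂ} (hw : ‖w‖ < 1) :
    ‖diskExt g w‖ < 1 := by
  by_cases h : w = 0
  · simp [h, diskExt_zero]
  · rw [diskExt, if_neg h, Complex.norm_exp, Real.exp_lt_one_iff]
    exact logExt_re_neg hm hc (log_re_neg h hw)

lemma diskExt_of_norm_eq_one {w : ℂ} (hw : ‖w‖ = 1) :
    diskExt g w = Complex.exp (g (Complex.arg w) * Complex.I) := by
  have h : w ≠ 0 := by
    rintro rfl
    simp at hw
  rw [diskExt, if_neg h, logExt_of_re_eq_zero (by simp [Complex.log_re, hw]), Complex.log_im]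

lemma ball_subset_image_diskExt (hm : StrictMono g) (hc : Continuous g)
    (hp : ∀ θ, g (θ + 2 * π) = g θ + 2 * π) :
    Metric.ball (0 : ℂ) 1 ⊆ diskExt g '' Metric.ball 0 1 := by
  have hopen : IsOpen (diskExt g '' Metric.ball 0 1) := by
    rw [isOpen_iff_mem_nhds]
    rintro _ ⟨w, hw, rfl⟩
    have hw' := mem_ball_zero_iff.1 hw
    have h1 := (contDiffAt_diskExt hc hp hw').hasStrictFDerivAt one_ne_zero
    have h2 := det_fderiv_diskExt_pos hm hc hp hw'
    rw [← ContinuousLinearMap.coe_toContinuousLinearEquivOfDetNeZero _ h2.ne'] at h1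
    rw [← h1.map_nhds_eq_of_equiv]
    exact Filter.image_mem_map (Metric.isOpen_ball.mem_nhds hw)
  have hclosed : IsClosed (diskExt g '' Metric.closedBall 0 1) :=
    ((isCompact_closedBall (0 : ℂ) 1).image (continuous_diskExt hc hp)).isClosed
  refine (convex_ball (0 : ℂ) 1).isPreconnected.subset_left_of_subset_union hopen
    hclosed.isOpen_compl ?_ ?_ ?_
  · exact (disjoint_compl_right).mono_left (image_mono Metric.ball_subset_closedBall)
  · intro z hz
    by_contra hcon
    rw [mem_union, not_or, mem_compl_iff, not_not] at hcon
    obtain ⟨h1, w, hw, rfl⟩ := hcon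
    rcases (mem_closedBall_zero_iff.1 hw).lt_or_eq with h | h
    · exact h1 ⟨w, mem_ball_zero_iff.2 h, rfl⟩
    · rw [mem_ball_zero_iff, diskExt_of_norm_eq_one h, Complex.norm_exp_ofReal_mul_I] at hz
      exact lt_irrefl _ hz
  · exact ⟨0, by simp, 0, by simp, diskExt_zero⟩

lemma exists_homeomorph_diskExt (hm : StrictMono g) (hc : Continuous g)
    (hp : ∀ θ, g (θ + 2 * π) = g θ + 2 * π) :
    ∃ E : Metric.closedBall (0 : ℂ) 1 ≃ₜ Metric.closedBall (0 : ℂ) 1,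
      ∀ p : Metric.closedBall (0 : ℂ) 1, (E p : ℂ) = diskExt g p := by
  have hmaps : MapsTo (diskExt g) (Metric.closedBall 0 1) (Metric.closedBall 0 1) := by
    intro w hw
    rw [mem_closedBall_zero_iff] at hw ⊢
    rcases hw.lt_or_eq with h | h
    · exact (norm_diskExt_lt_one hm hc h).le
    · rw [diskExt_of_norm_eq_one h, Complex.norm_exp_ofReal_mul_I]
  have hsurj : SurjOn (diskExt g) (Metric.closedBall 0 1) (Metric.closedBall 0 1) := by
    rw [SurjOn, ← closure_ball (0 : ℂ) one_ne_zero]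
    refine closure_minimal ((ball_subset_image_diskExt hm hc hp).trans
      (image_mono subset_closure)) ?_
    rw [closure_ball (0 : ℂ) one_ne_zero]
    exact ((isCompact_closedBall (0 : ℂ) 1).image (continuous_diskExt hc hp)).isClosed
  have hbij : BijOn (diskExt g) (Metric.closedBall 0 1) (Metric.closedBall 0 1) :=
    ⟨hmaps, (injective_diskExt hm hc hp).injOn, hsurj⟩
  have hcont : Continuous (hbij.equiv (diskExt g)) :=
    ((continuous_diskExt hc hp).comp continuous_subtype_val).subtype_mk _
  have : CompactSpace (Metric.closedBall (0 : ℂ) 1) :=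
    isCompact_iff_compactSpace.1 (isCompact_closedBall 0 1)
  exact ⟨hcont.homeoOfEquivCompactToT2, fun p => rfl⟩

lemma exists_dilC_diskExt_le (hm : StrictMono g) (hc : Continuous g)
    (hp : ∀ θ, g (θ + 2 * π) = g θ + 2 * π) {r : ℝ} (hr : r < 1) :
    ∃ C, ∀ w ∈ Metric.closedBall (0 : ℂ) r, dilC (diskExt g) w ≤ C := by
  have hsub : ∀ w ∈ Metric.closedBall (0 : ℂ) r, ‖w‖ < 1 := fun w hw =>
    (mem_closedBall_zero_iff.1 hw).trans_lt hr
  have h1 : ContinuousOn (fderiv ℝ (diskExt g)) (Metric.closedBall 0 r) := fun w hw =>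
    ((contDiffAt_diskExt hc hp (hsub w hw)).continuousAt_fderiv one_ne_zero).continuousWithinAt
  have h2 : ContinuousOn (dilC (diskExt g)) (Metric.closedBall 0 r) :=
    (h1.norm.pow 2).div (ContinuousLinearMap.continuous_det.comp_continuousOn h1) fun w hw =>
      (det_fderiv_diskExt_pos hm hc hp (hsub w hw)).ne'
  obtain ⟨C, hC⟩ := (isCompact_closedBall (0 : ℂ) r).bddAbove_image h2
  exact ⟨C, fun w hw => hC ⟨w, hw, rfl⟩⟩

end DiskExt

/-! ### Integrability of the dilatation -/

lemma arcLen_exp {a b : ℝ} (h : a ≤ b) (h' : b < a + 2 * π) :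
    arcLen (Circle.exp a) (Circle.exp b) = b - a := by
  have hexp : (Circle.exp b : ℂ) / (Circle.exp a : ℂ) = Complex.exp ((b - a : ℝ) * Complex.I) := by
    rw [Circle.coe_exp, Circle.coe_exp, ← Complex.exp_sub]
    push_cast
    ring_nf
  have hpi := Real.pi_pos
  rw [arcLen, hexp, Complex.arg_exp_mul_I]
  rcases le_or_gt (b - a) π with hle | hgt
  · rw [(toIocMod_eq_iff Real.two_pi_pos).2
      ⟨⟨by linarith, by linarith⟩, 0, (by simp : b - a = b - a + (0 : ℤ) • (2 * π))⟩,
      if_pos (sub_nonneg.2 h)]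
  · rw [(toIocMod_eq_iff Real.two_pi_pos).2
      ⟨⟨by linarith, by linarith⟩, 1, (by simp : b - a = b - a - 2 * π + (1 : ℤ) • (2 * π))⟩,
      if_neg (by linarith)]
    ring

lemma rhoCirc_eq_symRatio {h : Circle → Circle} {g : ℝ → ℝ} (hm : StrictMono g)
    (hp : ∀ θ, g (θ + 2 * π) = g θ + 2 * π) (hg : ∀ θ, h (Circle.exp θ) = Circle.exp (g θ))
    (θ : ℝ) {t : ℝ} (ht : 0 < t) (ht' : t < 2 * π) : rhoCirc h θ t = symRatio g θ t := by
  have h1 : g (θ + t) < g θ + 2 * π := by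
    rw [← hp]
    exact hm (by linarith)
  have h2 : g θ < g (θ - t) + 2 * π := by
    rw [← hp]
    exact hm (by linarith)
  rw [rhoCirc, symRatio, hg, hg, hg, arcLen_exp (hm.monotone (by linarith)) h1,
    arcLen_exp (hm.monotone (by linarith)) h2]

lemma measurable_shear {F : ℝ → ℝ → ENNReal} (hF : Measurable (uncurry F)) (c d : ℝ) :
    Measurable fun ζ : ℂ => F (ζ.im + c * -ζ.re) (d * -ζ.re) := by
  have h : Measurable fun ζ : ℂ => (ζ.im + c * -ζ.re, d * -ζ.re) :=
    (Complex.measurable_im.add (Complex.measurable_re.neg.const_mul c)).prodMk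
      (Complex.measurable_re.neg.const_mul d)
  exact hF.comp h

lemma lintegral_shear_lt_top {F : ℝ → ℝ → ENNReal} (hF : Measurable (uncurry F))
    (hper : ∀ x t, F (x + 2 * π) t = F x t)
    (hint : ∫⁻ θ in Icc 0 (2 * π), ∫⁻ t in Ioo 0 (π / 2), F θ t < ⊤) (c : ℝ) {d : ℝ}
    (hd : 0 < d) (hd' : d ≤ 1) :
    ∫⁻ ζ in Ioo (-1) 0 ×ℂ Ioc (-π) π, F (ζ.im + c * -ζ.re) (d * -ζ.re) < ⊤ := by
  have hinner : ∀ a s : ℝ, ∫⁻ x in Ioc (-π) π, F (x + a) s ≤ ∫⁻ x in Icc 0 (2 * π), F x s := by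
    intro a s
    have hinv : ∀ (n : AddSubgroup.zmultiples (2 * π)) (x : ℝ), F (n +ᵥ x) s = F x s := by
      rintro ⟨_, n, rfl⟩ x
      have := (show Periodic (fun x => F x s) (2 * π) from fun x => hper x s).zsmul n x
      rw [← this, AddSubgroup.vadd_def, vadd_eq_add, add_comm]
    have htrans := (measurePreserving_add_right volume a).setLIntegral_comp_preimage_emb
      (measurableEmbedding_addRight a) (fun x => F x s) (Ioc (-π + a) (π + a))
    rw [preimage_add_const_Ioc, add_sub_cancel_right, add_sub_cancel_right] at htrans
    rw [htrans, show π + a = -π + a + 2 * π by ring,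
      (isAddFundamentalDomain_Ioc Real.two_pi_pos (-π + a) volume).setLIntegral_eq
        (isAddFundamentalDomain_Ioc Real.two_pi_pos 0 volume) (fun x => F x s) hinv, zero_add]
    exact lintegral_mono_set Ioc_subset_Icc_self
  have hmeas : Measurable fun z : ℝ × ℝ => F (z.2 + c * -z.1) (d * -z.1) :=
    hF.comp (by fun_prop : Measurable fun z : ℝ × ℝ => (z.2 + c * -z.1, d * -z.1))
  have hprod := Complex.volume_preserving_equiv_real_prod.setLIntegral_comp_preimage_emb
    Complex.measurableEquivRealProd.measurableEmbedding
    (fun z : ℝ × ℝ => F (z.2 + c * -z.1) (d * -z.1)) (Ioo (-1) 0 ×ˢ Ioc (-π) π)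
  have hscale := lintegral_image_eq_lintegral_abs_deriv_mul
    (measurableSet_Ioo (a := (-1 : ℝ)) (b := 0))
    (f := fun x => d * -x) (f' := fun _ => d * -1)
    (fun x _ => (((hasDerivAt_id x).neg).const_mul d).hasDerivWithinAt)
    (fun x _ y _ h => neg_injective (mul_left_cancel₀ hd.ne' h))
    (fun s => ∫⁻ x in Icc 0 (2 * π), F x s)
  have hfin : ∫⁻ s in (fun x => d * -x) '' Ioo (-1) 0, ∫⁻ x in Icc 0 (2 * π), F x s < ⊤ := by
    refine (lintegral_mono_set ?_).trans_lt
      ((lintegral_lintegral_swap hF.aemeasurable).symm.trans_lt hint)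
    rintro _ ⟨x, ⟨hx, hx'⟩, rfl⟩
    have := Real.pi_gt_three
    exact ⟨mul_pos hd (neg_pos.2 hx'), by nlinarith⟩
  rw [hscale, lintegral_const_mul' _ _ ENNReal.ofReal_ne_top] at hfin
  calc _ = ∫⁻ z in Ioo (-1) 0 ×ˢ Ioc (-π) π, F (z.2 + c * -z.1) (d * -z.1) := hprod
    _ = ∫⁻ y in Ioo (-1) 0, ∫⁻ x in Ioc (-π) π, F (x + c * -y) (d * -y) :=
      setLIntegral_prod _ hmeas.aemeasurable
    _ ≤ ∫⁻ y in Ioo (-1) 0, ∫⁻ x in Icc 0 (2 * π), F x (d * -y) :=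
      lintegral_mono fun y => hinner _ _
    _ < ⊤ := by
      refine ENNReal.lt_top_of_mul_ne_top_right hfin.ne ?_
      simp [hd.ne']

lemma symRatio_add_period {g : ℝ → ℝ} (hp : ∀ θ, g (θ + 2 * π) = g θ + 2 * π) (x t : ℝ) :
    symRatio g (x + 2 * π) t = symRatio g x t := by
  rw [symRatio, symRatio, show x + 2 * π + t = x + t + 2 * π by ring,
    show x + 2 * π - t = x - t + 2 * π by ring, hp, hp, hp]
  simp

lemma lintegral_exp_dilC_lt_top {g : ℝ → ℝ} (hm : StrictMono g) (hc : Continuous g)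
    (hp : ∀ θ, g (θ + 2 * π) = g θ + 2 * π) {q : ℝ} (hq : 0 < q)
    (hint : ∫⁻ θ in Icc 0 (2 * π), ∫⁻ t in Ioo 0 (π / 2),
      ENNReal.ofReal (Real.exp (q * symRatio g θ t)) < ⊤) :
    ∫⁻ w in Metric.ball (0 : ℂ) 1,
      ENNReal.ofReal (Real.exp (q / 288 * dilC (diskExt g) w)) < ⊤ := by
  set S : Set ℂ := Ioo (-1) 0 ×ℂ Ioc (-π) π
  have hS : MeasurableSet S := (Complex.measurable_re measurableSet_Ioo).inter
    (Complex.measurable_im measurableSet_Ioc)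
  set F : ℝ → ℝ → ENNReal := fun x t => ENNReal.ofReal (Real.exp (q * symRatio g x t)) with hFdef
  have hF : Measurable (uncurry F) := by
    have h1 : Measurable fun z : ℝ × ℝ => g (z.1 + z.2) - g z.1 := by fun_prop
    have h2 : Measurable fun z : ℝ × ℝ => g z.1 - g (z.1 - z.2) := by fun_prop
    exact (((h1.div h2).max (h2.div h1)).const_mul q).exp.ennreal_ofReal
  have hper : ∀ x t, F (x + 2 * π) t = F x t := fun x t => by
    simp only [hFdef, symRatio_add_period hp]
  have hfin := lintegral_shear_lt_top hF hper hint
  have hcover : Metric.ball (0 : ℂ) 1 ⊆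
      Metric.closedBall 0 (Real.exp (-1)) ∪ Complex.exp '' S := by
    intro w hw
    rw [mem_ball_zero_iff] at hw
    rcases le_or_gt ‖w‖ (Real.exp (-1)) with h | h
    · exact Or.inl (mem_closedBall_zero_iff.2 h)
    · have hw₀ : w ≠ 0 := norm_pos_iff.1 ((Real.exp_pos _).trans h)
      refine Or.inr ⟨Complex.log w, ⟨⟨?_, log_re_neg hw₀ hw⟩, ?_, ?_⟩, Complex.exp_log hw₀⟩
      · rw [Complex.log_re]
        exact (Real.lt_log_iff_exp_lt (norm_pos_iff.2 hw₀)).2 h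
      · exact Complex.neg_pi_lt_log_im w
      · exact Complex.log_im_le_pi w
  refine (lintegral_mono_set hcover).trans_lt ((lintegral_union_le _ _ _).trans_lt
    (ENNReal.add_lt_top.2 ⟨?_, ?_⟩))
  · obtain ⟨C, hC⟩ := exists_dilC_diskExt_le hm hc hp (Real.exp_lt_one_iff.2 neg_one_lt_zero)
    calc _ ≤ ∫⁻ _ in Metric.closedBall (0 : ℂ) (Real.exp (-1)),
          ENNReal.ofReal (Real.exp (q / 288 * C)) :=
        setLIntegral_mono measurable_const fun w hw => by
          have := hC w hw
          gcongr
      _ < ⊤ := by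
        rw [setLIntegral_const]
        exact ENNReal.mul_lt_top ENNReal.ofReal_lt_top measure_closedBall_lt_top
  · rw [lintegral_image_eq_lintegral_abs_det_fderiv_mul volume hS
      (fun ζ _ => (Complex.hasDerivAt_exp ζ).complexToReal_fderiv.hasFDerivWithinAt)
      (fun z hz w hw h => by
        rw [← Complex.log_exp hz.2.1 hz.2.2, h, Complex.log_exp hw.2.1 hw.2.2])]
    refine lt_of_le_of_lt ?_ (ENNReal.add_lt_top.2 ⟨hfin 0 one_pos le_rfl, ENNReal.add_lt_top.2
      ⟨hfin (-1 / 4) (d := 3 / 4) (by norm_num) (by norm_num),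
        hfin (1 / 4) (d := 3 / 4) (by norm_num) (by norm_num)⟩⟩)
    have hadd := measurable_shear hF
    rw [← lintegral_add_left (hadd (-1 / 4) (3 / 4)), ← lintegral_add_left (hadd 0 1)]
    refine setLIntegral_mono ((hadd _ _).add ((hadd _ _).add (hadd _ _))) fun ζ hζ => ?_
    obtain ⟨⟨hre, hre'⟩, him, him'⟩ := hζ
    have hlog := Complex.log_exp him him'
    have hnorm : ‖Complex.exp ζ‖ < 1 := by rwa [Complex.norm_exp, Real.exp_lt_one_iff]
    have hdet : |(Complex.exp ζ • (1 : ℂ →L[ℝ] ℂ)).det| ≤ 1 := by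
      rw [det_smul_one, abs_of_nonneg (by positivity)]
      exact pow_le_one₀ (norm_nonneg _) hnorm.le
    have hdil : dilC (diskExt g) (Complex.exp ζ) ≤ 288 * maxRatio g ζ.im (-ζ.re) := by
      have h1 := dilC_diskExt_le hm hc hp (Complex.exp_ne_zero ζ) hnorm
      rw [hlog] at h1
      exact h1.trans (dilC_logExt_le hm hc hre' (by linarith [Real.pi_gt_three]))
    have hexp : ENNReal.ofReal (Real.exp (q / 288 * dilC (diskExt g) (Complex.exp ζ))) ≤
        ENNReal.ofReal (Real.exp (q * maxRatio g ζ.im (-ζ.re))) := by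
      refine ENNReal.ofReal_le_ofReal (Real.exp_le_exp.2 ?_)
      calc _ ≤ q / 288 * (288 * maxRatio g ζ.im (-ζ.re)) := by gcongr
        _ = _ := by ring
    have hmax : ENNReal.ofReal (Real.exp (q * maxRatio g ζ.im (-ζ.re))) =
        max (F (ζ.im + 0 * -ζ.re) (1 * -ζ.re)) (max (F (ζ.im + -1 / 4 * -ζ.re) (3 / 4 * -ζ.re))
          (F (ζ.im + 1 / 4 * -ζ.re) (3 / 4 * -ζ.re))) := by
      have hmono : Monotone fun s => ENNReal.ofReal (Real.exp (q * s)) := fun s t h => by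
        dsimp only
        gcongr
      rw [maxRatio, hmono.map_max, hmono.map_max]
      simp only [hFdef]
      ring_nf
    calc _ ≤ 1 * ENNReal.ofReal (Real.exp (q * maxRatio g ζ.im (-ζ.re))) :=
          mul_le_mul' (ENNReal.ofReal_le_one.2 hdet) hexp
      _ ≤ _ := by
        rw [one_mul, hmax]
        exact (max_le_add_of_nonneg zero_le zero_le).trans
          (add_le_add_right (max_le_add_of_nonneg zero_le zero_le) _)

/-- If `h : S¹ → S¹` is an orientation-preserving homeomorphism with
`∫₀^{2π} ∫₀^{π/2} e^{q ρ_h^c(θ,t)} dt dθ < ∞` for some `q > 0`, then `h` extends to an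
orientation-preserving homeomorphism `H` of the closed unit disk, continuously differentiable
with positive Jacobian on the open disk, with exponentially integrable distortion:
`∫_𝔻 e^{p K_H} dx dy < ∞` for some `p > 0`. -/
theorem david_extension_circle (h : Circle → Circle) (hh : IsOrientationPresHomeo h)
    (q : ℝ) (hq : 0 < q)
    (hint : (∫⁻ θ in Icc (0 : ℝ) (2 * π), ∫⁻ t in Ioo (0 : ℝ) (π / 2),
      ENNReal.ofReal (Real.exp (q * rhoCirc h θ t))) < ⊤) :
    ∃ H : ℂ → ℂ,
      (∃ E : Metric.closedBall (0 : ℂ) 1 ≃ₜ Metric.closedBall (0 : ℂ) 1,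
        ∀ p : Metric.closedBall (0 : ℂ) 1, (E p : ℂ) = H p) ∧
      (∀ z : Circle, H z = h z) ∧
      ContDiffOn ℝ 1 H (Metric.ball (0 : ℂ) 1) ∧
      (∀ z ∈ Metric.ball (0 : ℂ) 1, 0 < (fderiv ℝ H z).det) ∧
      ∃ p : ℝ, 0 < p ∧
        ∫⁻ z in Metric.ball (0 : ℂ) 1, ENNReal.ofReal (Real.exp (p * dilC H z)) < ⊤ := by
  obtain ⟨g, hm, hc, -, hp, hg⟩ := hh
  refine ⟨diskExt g, exists_homeomorph_diskExt hm hc hp, fun z => ?_,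
    fun z hz => (contDiffAt_diskExt hc hp (mem_ball_zero_iff.1 hz)).contDiffWithinAt,
    fun z hz => det_fderiv_diskExt_pos hm hc hp (mem_ball_zero_iff.1 hz),
    q / 288, by positivity, lintegral_exp_dilC_lt_top hm hc hp hq ?_⟩
  · rw [diskExt_of_norm_eq_one (Circle.norm_coe z), ← Circle.coe_exp, ← hg, Circle.exp_arg]
  · convert hint using 3 with θ
    refine setLIntegral_congr_fun measurableSet_Ioo fun t ht => ?_
    rw [rhoCirc_eq_symRatio hm hp hg θ ht.1 (by linarith [ht.2, Real.pi_pos])]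
end
end

section
/- There exists a uniform constant C > 0 such that the following holds. Let h : ℝ → ℝ be an increasing homeomorphism and let A be a locally integrable function on the open upper half-plane ℍ whose BMO seminorm is at most M, i.e. for every closed ball B ⊆ ℍ, (1/|B|)∫_B |A − A_B| ≤ M where A_B = (1/|B|)∫_B A. Define Â(z) = (1/|B_z|)∫_{B_z} A, where B_z = B(z, Im(z)/2). Then: (a) if ρ_h(x,y) ≤ Â(x,y) for all (x,y) ∈ ℍ, then K_h(x,y) ≤ C·Â(x,y) + C·M for all (x,y) ∈ ℍ; and (b) if K_h(x,y) ≤ Â(x,y) for all (x,y) ∈ ℍ, then ρ_h(x,y) ≤ 4·Â(x,y) for all (x,y) ∈ ℍ. -/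
open MeasureTheory Set Function

noncomputable section

/-- The symmetric distortion function of an increasing homeomorphism `h : ℝ → ℝ`. -/
def rhoDist (h : ℝ → ℝ) (x t : ℝ) : ℝ :=
  max ((h (x + t) - h x) / (h x - h (x - t)))
      ((h x - h (x - t)) / (h (x + t) - h x))

/-- `u_x` partial derivative of the Beurling–Ahlfors extension. -/
def BAux (h : ℝ → ℝ) (x y : ℝ) : ℝ := (h (x + y) - h (x - y)) / (2 * y)

/-- `u_y` partial derivative of the Beurling–Ahlfors extension. -/
def BAuy (h : ℝ → ℝ) (x y : ℝ) : ℝ :=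
  (h (x + y) + h (x - y) - (1 / y) * (∫ t in x..(x + y), h t)
    - (1 / y) * (∫ t in (x - y)..x, h t)) / (2 * y)

/-- `v_x` partial derivative of the Beurling–Ahlfors extension. -/
def BAvx (h : ℝ → ℝ) (x y : ℝ) : ℝ := (h (x + y) + h (x - y) - 2 * h x) / (2 * y)

/-- `v_y` partial derivative of the Beurling–Ahlfors extension. -/
def BAvy (h : ℝ → ℝ) (x y : ℝ) : ℝ :=
  (h (x + y) - h (x - y) - (1 / y) * (∫ t in x..(x + y), h t)
    + (1 / y) * (∫ t in (x - y)..x, h t)) / (2 * y)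

/-- The quantity `(u_x² + u_y² + v_x² + v_y²)/(u_x v_y − u_y v_x)`, which equals
`K + 1/K` for the quasiconformal dilatation `K` of the Beurling–Ahlfors extension. -/
def BAdil (h : ℝ → ℝ) (x y : ℝ) : ℝ :=
  ((BAux h x y) ^ 2 + (BAuy h x y) ^ 2 + (BAvx h x y) ^ 2 + (BAvy h x y) ^ 2) /
    (BAux h x y * BAvy h x y - BAuy h x y * BAvx h x y)

/-- The open upper half-plane, as a subset of `ℝ × ℝ`. -/
def upperHP : Set (ℝ × ℝ) := {p | 0 < p.2}

/-- The density of the spherical measure `dσ = 4 dx dy/(1 + x² + y²)²`. -/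
def sphDen (p : ℝ × ℝ) : ℝ := 4 / (1 + p.1 ^ 2 + p.2 ^ 2) ^ 2

/-- The closed Euclidean ball of center `c` and radius `r` in `ℝ × ℝ`. -/
def eBall (c : ℝ × ℝ) (r : ℝ) : Set (ℝ × ℝ) :=
  {p | (p.1 - c.1) ^ 2 + (p.2 - c.2) ^ 2 ≤ r ^ 2}

/-- The average of `A` over a set `s` (with respect to Lebesgue measure). -/
def setAvg (A : ℝ × ℝ → ℝ) (s : Set (ℝ × ℝ)) : ℝ :=
  (∫ p in s, A p) / (MeasureTheory.volume s).toReal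

/-- `Â(z)`: the average of `A` over the ball `B(z, Im z / 2)`. -/
def hatAvg (A : ℝ × ℝ → ℝ) (p : ℝ × ℝ) : ℝ := setAvg A (eBall p (p.2 / 2))

/-- `Ǎ(x,y)`: the average of `A` over the `2y × y` rectangle centered at `(x,y)`,
`(1/(2y²)) ∫_{y/2}^{3y/2} ∫_{x−y}^{x+y} A`. -/
def checkAvg (A : ℝ × ℝ → ℝ) (x y : ℝ) : ℝ :=
  (1 / (2 * y ^ 2)) * ∫ t in (y / 2)..(3 * y / 2), ∫ s in (x - y)..(x + y), A (s, t)

/-- `A` is locally integrable on the open upper half-plane, in the sense that it is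
integrable on every closed ball contained in it. -/
def LocIntUHP (A : ℝ × ℝ → ℝ) : Prop :=
  ∀ (c : ℝ × ℝ) (r : ℝ), 0 < r → eBall c r ⊆ upperHP →
    MeasureTheory.IntegrableOn A (eBall c r)

/-- The BMO seminorm of `A` on the open upper half-plane is at most `M`: for every closed
ball `B ⊆ ℍ`, `(1/|B|) ∫_B |A − A_B| ≤ M`. -/
def BMOSeminormLE (A : ℝ × ℝ → ℝ) (M : ℝ) : Prop :=
  ∀ (c : ℝ × ℝ) (r : ℝ), 0 < r → eBall c r ⊆ upperHP →
    (∫ p in eBall c r, |A p - setAvg A (eBall c r)|) /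
      (MeasureTheory.volume (eBall c r)).toReal ≤ M

theorem eBall_eq_preimage (c : ℝ × ℝ) {r : ℝ} (hr : 0 ≤ r) :
    eBall c r = Complex.measurableEquivRealProd.symm ⁻¹'
      Metric.closedBall (Complex.measurableEquivRealProd.symm c) r := by
  ext p
  simp only [eBall, mem_ofPred_eq, mem_preimage, Metric.mem_closedBall, Complex.dist_eq_re_im,
    Complex.measurableEquivRealProd_symm_apply]
  rw [Real.sqrt_le_left hr]

theorem volume_eBall (c : ℝ × ℝ) {r : ℝ} (hr : 0 ≤ r) :
    volume (eBall c r) = ENNReal.ofReal r ^ 2 * NNReal.pi := by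
  rw [eBall_eq_preimage c hr,
    (Complex.volume_preserving_equiv_real_prod.symm).measure_preimage_equiv,
    Complex.volume_closedBall]

theorem toReal_volume_eBall (c : ℝ × ℝ) {r : ℝ} (hr : 0 ≤ r) :
    (volume (eBall c r)).toReal = r ^ 2 * Real.pi := by
  rw [volume_eBall c hr]
  simp [ENNReal.toReal_ofReal hr]

theorem eBall_subset_eBall {c d : ℝ × ℝ} {r s : ℝ} (hr : 0 ≤ r) (hrs : r ≤ s)
    (h : (c.1 - d.1) ^ 2 + (c.2 - d.2) ^ 2 ≤ (s - r) ^ 2) : eBall c r ⊆ eBall d s := by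
  have hs : 0 ≤ s := hr.trans hrs
  rw [eBall_eq_preimage c hr, eBall_eq_preimage d hs]
  refine preimage_mono (Metric.closedBall_subset_closedBall' ?_)
  have : dist (Complex.measurableEquivRealProd.symm c) (Complex.measurableEquivRealProd.symm d)
      ≤ s - r := by
    simp only [Complex.dist_eq_re_im, Complex.measurableEquivRealProd_symm_apply]
    exact (Real.sqrt_le_left (sub_nonneg.2 hrs)).2 h
  linarith

theorem eBall_subset_upperHP {c : ℝ × ℝ} {r : ℝ} (hr : 0 ≤ r) (h : r < c.2) :
    eBall c r ⊆ upperHP := by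
  intro p hp
  have hp' : (p.1 - c.1) ^ 2 + (p.2 - c.2) ^ 2 ≤ r ^ 2 := hp
  have : |p.2 - c.2| ≤ r := abs_le_of_sq_le_sq (by nlinarith [sq_nonneg (p.1 - c.1)]) hr
  change 0 < p.2
  linarith [(abs_le.1 this).1]

/-- Averages over a set and over a subset differ by at most the total oscillation divided by the
measure of the subset. -/
theorem abs_setAvg_sub_le {A : ℝ × ℝ → ℝ} {S T : Set (ℝ × ℝ)}
    (hST : S ⊆ T) (hA : IntegrableOn A T) (hvS : 0 < (volume S).toReal)
    (hvT : volume T ≠ ⊤) (m : ℝ) :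
    |setAvg A S - m| ≤ (∫ p in T, |A p - m|) / (volume S).toReal := by
  have hvS' : volume S ≠ ⊤ := measure_ne_top_of_subset hST hvT
  have hAm : IntegrableOn (fun p => A p - m) T := hA.sub (integrableOn_const hvT)
  have h1 : setAvg A S - m = (∫ p in S, (A p - m)) / (volume S).toReal := by
    rw [integral_sub (hA.mono_set hST) (integrableOn_const hvS')]
    simp only [setAvg, setIntegral_const, smul_eq_mul, measureReal_def]
    field_simp
  rw [h1, abs_div, abs_of_pos hvS]
  gcongr
  calc |∫ p in S, (A p - m)| ≤ ∫ p in S, |A p - m| := abs_integral_le_integral_abs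
    _ ≤ ∫ p in T, |A p - m| :=
      setIntegral_mono_set hAm.abs (ae_of_all _ fun _ => abs_nonneg _) hST.eventuallyLE

theorem abs_setAvg_eBall_sub_le {A : ℝ × ℝ → ℝ} {M : ℝ} (hA : LocIntUHP A)
    (hM : BMOSeminormLE A M) {c d : ℝ × ℝ} {r s : ℝ} (hr : 0 < r) (hs : 0 < s)
    (hsub : eBall c r ⊆ eBall d s) (hU : eBall d s ⊆ upperHP) :
    |setAvg A (eBall c r) - setAvg A (eBall d s)| ≤ (s / r) ^ 2 * M := by
  have hπ := Real.pi_pos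
  have hvr := toReal_volume_eBall c hr.le
  have hvs := toReal_volume_eBall d hs.le
  have h1 := hM d s hs hU
  rw [hvs, div_le_iff₀ (by positivity)] at h1
  have h2 := abs_setAvg_sub_le hsub (hA d s hs hU)
    (by rw [hvr]; positivity)
    (by rw [volume_eBall d hs.le]; finiteness) (setAvg A (eBall d s))
  rw [hvr] at h2
  refine h2.trans ?_
  rw [div_le_iff₀ (by positivity)]
  refine h1.trans_eq ?_
  field_simp

theorem BMOSeminormLE.nonneg {A : ℝ × ℝ → ℝ} {M : ℝ} (hM : BMOSeminormLE A M) : 0 ≤ M := by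
  refine le_trans ?_ (hM (0, 2) 1 one_pos (eBall_subset_upperHP zero_le_one (by norm_num)))
  exact div_nonneg (integral_nonneg fun _ => abs_nonneg _) ENNReal.toReal_nonneg

theorem hatAvg_le_hatAvg_add {A : ℝ × ℝ → ℝ} {M : ℝ} (hA : LocIntUHP A)
    (hM : BMOSeminormLE A M) {x y x' : ℝ} (hy : 0 < y) (hx' : |x' - x| ≤ y / 4) :
    hatAvg A (x', 3 * y / 4) ≤ hatAvg A (x, y) + 7 * M := by
  have hU : eBall (x, y) (3 * y / 4) ⊆ upperHP :=
    eBall_subset_upperHP (by positivity) (by simp only; linarith)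
  have h1 := abs_setAvg_eBall_sub_le hA hM (c := (x, y)) (r := y / 2) (by positivity)
    (by positivity)
    (eBall_subset_eBall (by positivity) (by linarith) (by simp only [sub_self]; nlinarith)) hU
  have hsq : (x' - x) ^ 2 ≤ (y / 4) ^ 2 := sq_le_sq' (by linarith [(abs_le.1 hx').1])
    (abs_le.1 hx').2
  have h2 := abs_setAvg_eBall_sub_le hA hM (c := (x', 3 * y / 4)) (r := 3 * y / 4 / 2)
    (by positivity) (by positivity)
    (eBall_subset_eBall (by positivity) (by linarith) (by simp only; nlinarith)) hU
  have e1 : (3 * y / 4 / (y / 2)) ^ 2 = 9 / 4 := by field_simp; norm_num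
  have e2 : (3 * y / 4 / (3 * y / 4 / 2)) ^ 2 = 4 := by field_simp; norm_num
  rw [e1] at h1
  rw [e2] at h2
  have hM0 := hM.nonneg
  simp only [hatAvg]
  linarith [(abs_le.1 h1).1, (abs_le.1 h2).2]

/-- The dilatation quotient in terms of the increments `a`, `b` of `h` to the right and to the
left of `x`, and of the mean increments `α`, `β` from the outer endpoints. -/
theorem BAdil_eq (h : ℝ → ℝ) (x : ℝ) {y : ℝ} (hy : 0 < y) {a b α β : ℝ}
    (ha : a = h (x + y) - h x) (hb : b = h x - h (x - y))
    (hα : α = h (x + y) - (1 / y) * ∫ t in x..(x + y), h t)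
    (hβ : β = (1 / y) * (∫ t in (x - y)..x, h t) - h (x - y)) :
    BAdil h x y = (a ^ 2 + b ^ 2 + α ^ 2 + β ^ 2) / (a * β + b * α) := by
  have e1 : BAux h x y = (a + b) / (2 * y) := by rw [BAux, ha, hb]; ring
  have e2 : BAuy h x y = (α - β) / (2 * y) := by rw [BAuy, hα, hβ]; ring
  have e3 : BAvx h x y = (a - b) / (2 * y) := by rw [BAvx, ha, hb]; ring
  have e4 : BAvy h x y = (α + β) / (2 * y) := by rw [BAvy, hα, hβ]; ring
  rw [BAdil, e1, e2, e3, e4]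
  have hc : (1 / (2 * y ^ 2)) ≠ 0 := by positivity
  rw [← mul_div_mul_left (a ^ 2 + b ^ 2 + α ^ 2 + β ^ 2) _ hc]
  congr 1 <;> field_simp <;> ring

theorem Monotone.integral_le_mul {h : ℝ → ℝ} (hm : Monotone h) {a b : ℝ} (hab : a ≤ b) :
    ∫ t in a..b, h t ≤ (b - a) * h b := by
  have := intervalIntegral.integral_mono_on hab hm.intervalIntegrable
    (intervalIntegrable_const (c := h b) (μ := volume)) fun t ht => hm ht.2
  simpa using this

theorem Monotone.mul_le_integral {h : ℝ → ℝ} (hm : Monotone h) {a b : ℝ} (hab : a ≤ b) :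
    (b - a) * h a ≤ ∫ t in a..b, h t := by
  have := intervalIntegral.integral_mono_on hab
    (intervalIntegrable_const (c := h a) (μ := volume)) hm.intervalIntegrable fun t ht => hm ht.1
  simpa using this

theorem Monotone.integral_le_mul_add_mul {h : ℝ → ℝ} (hm : Monotone h) {a c b : ℝ}
    (hac : a ≤ c) (hcb : c ≤ b) :
    ∫ t in a..b, h t ≤ (c - a) * h c + (b - c) * h b := by
  rw [← intervalIntegral.integral_add_adjacent_intervals (b := c)
    hm.intervalIntegrable hm.intervalIntegrable]
  exact add_le_add (hm.integral_le_mul hac) (hm.integral_le_mul hcb)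

theorem Monotone.mul_add_mul_le_integral {h : ℝ → ℝ} (hm : Monotone h) {a c b : ℝ}
    (hac : a ≤ c) (hcb : c ≤ b) :
    (c - a) * h a + (b - c) * h c ≤ ∫ t in a..b, h t := by
  rw [← intervalIntegral.integral_add_adjacent_intervals (b := c)
    hm.intervalIntegrable hm.intervalIntegrable]
  exact add_le_add (hm.mul_le_integral hac) (hm.mul_le_integral hcb)

theorem dilatation_quotient_le {a b α β R : ℝ} (hb : 0 < b) (hba : b ≤ a) (hα : 0 ≤ α)
    (hαa : α ≤ a) (hβ : 0 ≤ β) (hβb : β ≤ b) (hR : 0 ≤ R) (hab : a ≤ R * b)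
    (hor : a ≤ 4 * α ∨ a ≤ 8 * (R * β)) :
    (a ^ 2 + b ^ 2 + α ^ 2 + β ^ 2) / (a * β + b * α) ≤ 32 * R := by
  have ha : 0 < a := hb.trans_le hba
  have h4 : a ^ 2 + b ^ 2 + α ^ 2 + β ^ 2 ≤ 4 * a ^ 2 := by nlinarith
  refine div_le_of_le_mul₀ (by positivity) (by positivity) (h4.trans ?_)
  have haβ : 0 ≤ R * (a * β) := by positivity
  have hbα : 0 ≤ R * (b * α) := by positivity
  rcases hor with h1 | h1
  · have : a * a ≤ (R * b) * (4 * α) := mul_le_mul hab h1 ha.le (by positivity)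
    nlinarith
  · have : a * a ≤ a * (8 * (R * β)) := mul_le_mul_of_nonneg_left h1 ha.le
    nlinarith

theorem sub_le_mul_of_rhoDist_le {h : ℝ → ℝ} (hh : StrictMono h) {x t R : ℝ} (ht : 0 < t)
    (hR : rhoDist h x t ≤ R) :
    h (x + t) - h x ≤ R * (h x - h (x - t)) ∧ h x - h (x - t) ≤ R * (h (x + t) - h x) := by
  have h1 : h (x - t) < h x := hh (by linarith)
  have h2 : h x < h (x + t) := hh (by linarith)
  obtain ⟨e1, e2⟩ := max_le_iff.1 hR
  exact ⟨(div_le_iff₀ (by linarith)).1 e1, (div_le_iff₀ (by linarith)).1 e2⟩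

theorem rhoDist_nonneg {h : ℝ → ℝ} (hm : Monotone h) (x : ℝ) {t : ℝ} (ht : 0 ≤ t) :
    0 ≤ rhoDist h x t :=
  le_max_of_le_left <| div_nonneg (sub_nonneg.2 (hm (by linarith)))
    (sub_nonneg.2 (hm (by linarith)))

/-- The dilatation is controlled linearly by three values of the symmetric distortion. -/
theorem BAdil_le_of_rhoDist_le {h : ℝ → ℝ} (hh : StrictMono h) {x y R : ℝ} (hy : 0 < y)
    (h0 : rhoDist h x y ≤ R) (h1 : rhoDist h (x - y / 4) (3 * y / 4) ≤ R)
    (h2 : rhoDist h (x + y / 4) (3 * y / 4) ≤ R) : BAdil h x y ≤ 32 * R := by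
  have hm := hh.monotone
  obtain ⟨h0a, h0b⟩ := sub_le_mul_of_rhoDist_le hh hy h0
  have h1a := (sub_le_mul_of_rhoDist_le hh (by positivity) h1).1
  have h2b := (sub_le_mul_of_rhoDist_le hh (by positivity) h2).2
  rw [show x - y / 4 + 3 * y / 4 = x + y / 2 by ring,
    show x - y / 4 - 3 * y / 4 = x - y by ring] at h1a
  rw [show x + y / 4 + 3 * y / 4 = x + y by ring,
    show x + y / 4 - 3 * y / 4 = x - y / 2 by ring] at h2b
  have hxm : h (x - y) < h x := hh (by linarith)
  have hxp : h x < h (x + y) := hh (by linarith)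
  have hq1 : h (x - y / 4) ≤ h x := hm (by linarith)
  have hq2 : h x ≤ h (x + y / 4) := hm (by linarith)
  have hR : 0 ≤ R := by
    by_contra hneg
    nlinarith
  have scale : ∀ I : ℝ, y * (1 / y * I) = I := fun I => by field_simp
  obtain ⟨α, hα⟩ : ∃ α, α = h (x + y) - (1 / y) * ∫ t in x..(x + y), h t := ⟨_, rfl⟩
  obtain ⟨β, hβ⟩ : ∃ β, β = (1 / y) * (∫ t in (x - y)..x, h t) - h (x - y) := ⟨_, rfl⟩
  have yα : y * α = y * h (x + y) - ∫ t in x..(x + y), h t := by rw [hα, mul_sub, scale]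
  have yβ : y * β = (∫ t in (x - y)..x, h t) - y * h (x - y) := by rw [hβ, mul_sub, scale]
  have α_nonneg : 0 ≤ α := by
    have := hm.integral_le_mul (a := x) (b := x + y) (by linarith)
    refine le_of_mul_le_mul_left ?_ hy
    linarith
  have α_le : α ≤ h (x + y) - h x := by
    have := hm.mul_le_integral (a := x) (b := x + y) (by linarith)
    refine le_of_mul_le_mul_left ?_ hy
    linarith
  have β_nonneg : 0 ≤ β := by
    have := hm.mul_le_integral (a := x - y) (b := x) (by linarith)
    refine le_of_mul_le_mul_left ?_ hy
    linarith
  have β_le : β ≤ h x - h (x - y) := by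
    have := hm.integral_le_mul (a := x - y) (b := x) (by linarith)
    refine le_of_mul_le_mul_left ?_ hy
    linarith
  have α_half : h (x + y) - h (x + y / 2) ≤ 2 * α := by
    have := hm.integral_le_mul_add_mul (a := x) (c := x + y / 2) (b := x + y)
      (by linarith) (by linarith)
    refine le_of_mul_le_mul_left ?_ hy
    linarith
  have α_quarter : h (x + y) - h (x + y / 4) ≤ 4 * α := by
    have := hm.integral_le_mul_add_mul (a := x) (c := x + y / 4) (b := x + y)
      (by linarith) (by linarith)
    refine le_of_mul_le_mul_left ?_ hy
    linarith
  have β_half : h (x - y / 2) - h (x - y) ≤ 2 * β := by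
    have := hm.mul_add_mul_le_integral (a := x - y) (c := x - y / 2) (b := x)
      (by linarith) (by linarith)
    refine le_of_mul_le_mul_left ?_ hy
    linarith
  have β_quarter : h (x - y / 4) - h (x - y) ≤ 4 * β := by
    have := hm.mul_add_mul_le_integral (a := x - y) (c := x - y / 4) (b := x)
      (by linarith) (by linarith)
    refine le_of_mul_le_mul_left ?_ hy
    linarith
  rw [BAdil_eq h x hy rfl rfl hα hβ]
  rcases le_total (h x - h (x - y)) (h (x + y) - h x) with hle | hle
  · refine dilatation_quotient_le (by linarith) hle α_nonneg α_le β_nonneg β_le hR h0a ?_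
    by_cases hc : h (x + y) - h x ≤ 2 * (h (x + y) - h (x + y / 2))
    · exact .inl (by linarith)
    · have := mul_le_mul_of_nonneg_left β_quarter hR
      exact .inr (by linarith)
  · have key := dilatation_quotient_le (a := h x - h (x - y)) (b := h (x + y) - h x)
      (by linarith) hle β_nonneg β_le α_nonneg α_le hR h0b ?_
    · convert key using 2 <;> ring
    · by_cases hc : h x - h (x - y) ≤ 2 * (h (x - y / 2) - h (x - y))
      · exact .inl (by linarith)
      · have := mul_le_mul_of_nonneg_left α_quarter hR
        exact .inr (by linarith)

theorem rhoDist_le_two_mul_BAdil {h : ℝ → ℝ} (hh : StrictMono h) {x y : ℝ} (hy : 0 < y)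
    (hpos : 0 < BAdil h x y) : rhoDist h x y ≤ 2 * BAdil h x y := by
  have hm := hh.monotone
  have hxm : h (x - y) < h x := hh (by linarith)
  have hxp : h x < h (x + y) := hh (by linarith)
  obtain ⟨α, hα⟩ : ∃ α, α = h (x + y) - (1 / y) * ∫ t in x..(x + y), h t := ⟨_, rfl⟩
  obtain ⟨β, hβ⟩ : ∃ β, β = (1 / y) * (∫ t in (x - y)..x, h t) - h (x - y) := ⟨_, rfl⟩
  have scale : ∀ I : ℝ, y * (1 / y * I) = I := fun I => by field_simp
  have α_le : α ≤ h (x + y) - h x := by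
    have := hm.mul_le_integral (a := x) (b := x + y) (by linarith)
    refine le_of_mul_le_mul_left ?_ hy
    rw [hα, mul_sub, scale]
    linarith
  have β_le : β ≤ h x - h (x - y) := by
    have := hm.integral_le_mul (a := x - y) (b := x) (by linarith)
    refine le_of_mul_le_mul_left ?_ hy
    rw [hβ, mul_sub, scale]
    linarith
  have hdil := BAdil_eq h x hy rfl rfl hα hβ
  obtain ⟨a, ha⟩ : ∃ a, a = h (x + y) - h x := ⟨_, rfl⟩
  obtain ⟨b, hb⟩ : ∃ b, b = h x - h (x - y) := ⟨_, rfl⟩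
  obtain ⟨D, hD⟩ : ∃ D, D = BAdil h x y := ⟨_, rfl⟩
  rw [rhoDist]
  rw [← hD] at hpos hdil ⊢
  rw [← ha] at hdil α_le ⊢
  rw [← hb] at hdil β_le ⊢
  have ha0 : 0 < a := by linarith
  have hb0 : 0 < b := by linarith
  have hne : a * β + b * α ≠ 0 := by
    intro h0
    rw [h0, div_zero] at hdil
    linarith
  rw [eq_div_iff hne] at hdil
  have hden : a * β + b * α ≤ 2 * (a * b) := by nlinarith
  have hmain : a ^ 2 + b ^ 2 ≤ D * (2 * (a * b)) := by
    nlinarith [mul_le_mul_of_nonneg_left hden hpos.le, sq_nonneg α, sq_nonneg β]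
  refine max_le ?_ ?_
  · rw [div_le_iff₀ hb0]
    refine le_of_mul_le_mul_left ?_ ha0
    nlinarith
  · rw [div_le_iff₀ ha0]
    refine le_of_mul_le_mul_left ?_ hb0
    nlinarith

/-- There is a uniform `C > 0` such that for any increasing homeomorphism
`h : ℝ → ℝ` with Beurling–Ahlfors dilatation `K`, and any `A ∈ BMO(ℍ)` with seminorm `≤ M`:
(a) if `ρ_h ≤ Â` on `ℍ` then `K ≤ C Â + C M` on `ℍ`; and
(b) if `K ≤ Â` on `ℍ` then `ρ_h ≤ 4 Â` on `ℍ`. -/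
theorem bmo_majorant_hat :
    ∃ C : ℝ, 0 < C ∧
      ∀ (h : ℝ → ℝ), StrictMono h → Surjective h →
      ∀ (K : ℝ → ℝ → ℝ),
        (∀ x y : ℝ, 0 < y → 1 ≤ K x y ∧ K x y + (K x y)⁻¹ = BAdil h x y) →
      ∀ (A : ℝ × ℝ → ℝ) (M : ℝ), LocIntUHP A → BMOSeminormLE A M →
        ((∀ p ∈ upperHP, rhoDist h p.1 p.2 ≤ hatAvg A p) →
          ∀ p ∈ upperHP, K p.1 p.2 ≤ C * hatAvg A p + C * M) ∧
        ((∀ p ∈ upperHP, K p.1 p.2 ≤ hatAvg A p) →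
          ∀ p ∈ upperHP, rhoDist h p.1 p.2 ≤ 4 * hatAvg A p) := by
  refine ⟨224, by norm_num, fun h hh _ K hK A M hA hM => ⟨?_, ?_⟩⟩
  · rintro hρ ⟨x, y⟩ (hy : 0 < y)
    obtain ⟨hK1, hKe⟩ := hK x y hy
    have hM0 := hM.nonneg
    have hinv : 0 < (K x y)⁻¹ := inv_pos.2 (by linarith)
    have hy' : 0 < 3 * y / 4 := by positivity
    have hdil : BAdil h x y ≤ 32 * (hatAvg A (x, y) + 7 * M) := by
      refine BAdil_le_of_rhoDist_le hh hy ?_ ?_ ?_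
      · linarith [hρ (x, y) hy]
      · exact (hρ (x - y / 4, 3 * y / 4) hy').trans (hatAvg_le_hatAvg_add hA hM hy
          (by rw [abs_le]; constructor <;> linarith))
      · exact (hρ (x + y / 4, 3 * y / 4) hy').trans (hatAvg_le_hatAvg_add hA hM hy
          (by rw [abs_le]; constructor <;> linarith))
    have hA0 : 0 ≤ hatAvg A (x, y) :=
      (rhoDist_nonneg hh.monotone x hy.le).trans (hρ (x, y) hy)
    simp only
    linarith
  · rintro hKA ⟨x, y⟩ (hy : 0 < y)
    obtain ⟨hK1, hKe⟩ := hK x y hy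
    have hinv : (K x y)⁻¹ ≤ 1 := inv_le_one_of_one_le₀ hK1
    have hinv0 : 0 < (K x y)⁻¹ := inv_pos.2 (by linarith)
    have h1 := rhoDist_le_two_mul_BAdil hh hy (by linarith)
    have h2 := hKA (x, y) hy
    simp only at h2 ⊢
    linarith
end
end
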